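/- arXiv:1309.3766 — 7 statements merged into one kernel-verified Lean document; each statement's English description precedes it below -/
import Mathlib

section
/- Let g = g₀ ⊕ g₁ be a Lie superalgebra over a field F of characteristic zero and let x, y ∈ g₁ and h ∈ g₀ be nonzero elements satisfying [h,x] = 2x, [h,y] = -2y, [x,y] = h, and such that {x, y, h} generates g as a Lie superalgebra. Then g = span_F{[x,x], [y,y], h, x, y}; in particular g is 5-dimensional, with g₀ = span_F{[x,x],[y,y],h} and g₁ = span_F{x,y}. -/
/-- A Lie superalgebra over `F`: a `ℤ/2`-graded vector space with a bilinear bracket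
satisfying super skew-symmetry and the super Jacobi identity on homogeneous elements. -/
structure LieSuperAlgebra (F : Type) [Field F] (L : Type) [AddCommGroup L] [Module F L] where
  bracket : L →ₗ[F] L →ₗ[F] L
  carrier : ZMod 2 → Submodule F L
  isCompl : IsCompl (carrier 0) (carrier 1)
  bracket_mem : ∀ i j : ZMod 2, ∀ x ∈ carrier i, ∀ y ∈ carrier j, bracket x y ∈ carrier (i + j)
  skew : ∀ i j : ZMod 2, ∀ x ∈ carrier i, ∀ y ∈ carrier j,
    bracket x y = -(((-1 : F) ^ (i.val * j.val)) • bracket y x)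
  super_jacobi : ∀ i j : ZMod 2, ∀ x ∈ carrier i, ∀ y ∈ carrier j, ∀ z : L,
    bracket (bracket x y) z
      = bracket x (bracket y z) - ((-1 : F) ^ (i.val * j.val)) • bracket y (bracket x z)

variable {F : Type} [Field F] {L : Type} [AddCommGroup L] [Module F L]

/-- An `osp`-triple for a Lie superalgebra: nonzero odd elements `e, f` and an even
element `h` generating `g`, with `[h,e] = 2e`, `[h,f] = -2f`, `[e,f] = h`. -/
structure LieSuperAlgebra.IsOspTriple (g : LieSuperAlgebra F L) (e f h : L) : Prop where
  e_mem : e ∈ g.carrier 1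
  f_mem : f ∈ g.carrier 1
  h_mem : h ∈ g.carrier 0
  e_ne : e ≠ 0
  f_ne : f ≠ 0
  h_ne : h ≠ 0
  he : g.bracket h e = (2 : F) • e
  hf : g.bracket h f = -((2 : F) • f)
  ef : g.bracket e f = h
  gen : ∀ S : Submodule F L, e ∈ S → f ∈ S → h ∈ S →
    (∀ x ∈ S, ∀ y ∈ S, g.bracket x y ∈ S) → S = ⊤

/-- A module over a Lie superalgebra. -/
structure LieSuperModule (g : LieSuperAlgebra F L)
    (V : Type) [AddCommGroup V] [Module F V] where
  act : L →ₗ[F] V →ₗ[F] V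
  carrier : ZMod 2 → Submodule F V
  isCompl : IsCompl (carrier 0) (carrier 1)
  act_mem : ∀ i j : ZMod 2, ∀ x ∈ g.carrier i, ∀ v ∈ carrier j, act x v ∈ carrier (i + j)
  bracket_act : ∀ i j : ZMod 2, ∀ x ∈ g.carrier i, ∀ y ∈ g.carrier j, ∀ v : V,
    act (g.bracket x y) v = act x (act y v) - ((-1 : F) ^ (i.val * j.val)) • act y (act x v)

variable {V : Type} [AddCommGroup V] [Module F V]

/-- A (graded) submodule of a Lie supermodule. -/
def LieSuperModule.IsSub {g : LieSuperAlgebra F L} (M : LieSuperModule g V)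
    (W : Submodule F V) : Prop :=
  W ≤ (W ⊓ M.carrier 0) ⊔ (W ⊓ M.carrier 1) ∧ ∀ x : L, ∀ v ∈ W, M.act x v ∈ W

/-- Irreducibility of a Lie supermodule. -/
def LieSuperModule.IsIrreducible {g : LieSuperAlgebra F L} (M : LieSuperModule g V) : Prop :=
  (∃ v : V, v ≠ 0) ∧ ∀ W : Submodule F V, M.IsSub W → W = ⊥ ∨ W = ⊤

/-- Isomorphism of Lie supermodules: a bijective linear map of some parity `p`
compatible with the actions up to the sign `(-1)^{|x| p}`. -/
def LieSuperModule.Iso {g : LieSuperAlgebra F L} {W : Type} [AddCommGroup W] [Module F W]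
    (M : LieSuperModule g V) (N : LieSuperModule g W) : Prop :=
  ∃ (φ : V ≃ₗ[F] W) (p : ZMod 2),
    (∀ j : ZMod 2, Submodule.map (φ : V →ₗ[F] W) (M.carrier j) = N.carrier (j + p)) ∧
    ∀ i : ZMod 2, ∀ x ∈ g.carrier i, ∀ v : V,
      φ (M.act x v) = ((-1 : F) ^ (i.val * p.val)) • N.act x (φ v)

namespace LieSuperAlgebra

variable (g : LieSuperAlgebra F L)

theorem bracket_comm_of_odd {a b : L} (ha : a ∈ g.carrier 1) (hb : b ∈ g.carrier 1) :
    g.bracket a b = g.bracket b a := by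
  simpa [ZMod.val_one] using g.skew 1 1 a ha b hb

theorem bracket_eq_neg_of_even {i : ZMod 2} {a b : L} (ha : a ∈ g.carrier 0)
    (hb : b ∈ g.carrier i) : g.bracket b a = -g.bracket a b := by
  simpa using g.skew i 0 b hb a ha

theorem bracket_bracket_of_odd {a b : L} (ha : a ∈ g.carrier 1) (hb : b ∈ g.carrier 1) (c : L) :
    g.bracket (g.bracket a b) c = g.bracket a (g.bracket b c) + g.bracket b (g.bracket a c) := by
  simpa [ZMod.val_one] using g.super_jacobi 1 1 a ha b hb c

theorem bracket_bracket_of_even {i : ZMod 2} {a b : L} (ha : a ∈ g.carrier 0)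
    (hb : b ∈ g.carrier i) (c : L) :
    g.bracket a (g.bracket b c) = g.bracket (g.bracket a b) c + g.bracket b (g.bracket a c) := by
  simpa using (sub_eq_iff_eq_add.mp (g.super_jacobi 0 i a ha b hb c).symm)

theorem bracket_self_mem_even {a : L} (ha : a ∈ g.carrier 1) : g.bracket a a ∈ g.carrier 0 :=
  g.bracket_mem 1 1 a ha a ha

/-- The square of an odd element commutes with that element. -/
theorem bracket_bracket_self_self [CharZero F] {a : L} (ha : a ∈ g.carrier 1) :
    g.bracket (g.bracket a a) a = 0 := by
  have hjac := g.bracket_bracket_of_odd ha ha a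
  rw [g.bracket_eq_neg_of_even (g.bracket_self_mem_even ha) ha] at hjac
  have hthree : (3 : F) • g.bracket (g.bracket a a) a = 0 := by
    linear_combination (norm := module) hjac
  exact (smul_eq_zero.mp hthree).resolve_left three_ne_zero

/-- An `ad h`-eigenvalue of an odd element doubles on its square. -/
theorem bracket_bracket_self_of_eigen {h a : L} {c : F} (hh : h ∈ g.carrier 0)
    (ha : a ∈ g.carrier 1) (hc : g.bracket h a = c • a) :
    g.bracket h (g.bracket a a) = (2 * c) • g.bracket a a := by
  rw [g.bracket_bracket_of_even hh ha, hc, map_smul, map_smul, LinearMap.smul_apply, two_mul,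
    add_smul]

end LieSuperAlgebra

/-- In a modular lattice, elements below the two halves of a complementary pair that jointly span
the top are equal to those halves. -/
theorem IsCompl.eq_and_eq_of_le_of_sup_eq_top {α : Type*} [Lattice α] [BoundedOrder α]
    [IsModularLattice α] {a b p q : α} (hpq : IsCompl p q) (ha : a ≤ p) (hb : b ≤ q)
    (hab : a ⊔ b = ⊤) : p = a ∧ q = b := by
  constructor
  · refine (eq_of_le_of_inf_le_of_sup_le ha (z := b) ?_ ?_).symm
    · exact ((inf_le_inf_left p hb).trans hpq.inf_eq_bot.le).trans bot_le
    · exact le_top.trans hab.ge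
  · refine (eq_of_le_of_inf_le_of_sup_le hb (z := a) ?_ ?_).symm
    · exact ((inf_le_inf_left q ha).trans hpq.symm.inf_eq_bot.le).trans bot_le
    · exact le_top.trans (sup_comm a b ▸ hab.ge)

/-- a Lie superalgebra generated by an `sl₂`-super triple of odd elements is
spanned by `[x,x], [y,y], h, x, y`; in particular it is 5-dimensional with the indicated
even and odd parts. -/
theorem osp_triple_span
    {F : Type} [Field F] [CharZero F] {L : Type} [AddCommGroup L] [Module F L]
    (g : LieSuperAlgebra F L) (x y h : L)
    (hx : x ∈ g.carrier 1) (hy : y ∈ g.carrier 1) (hh : h ∈ g.carrier 0)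
    (hx0 : x ≠ 0) (hy0 : y ≠ 0) (hh0 : h ≠ 0)
    (hhx : g.bracket h x = (2 : F) • x)
    (hhy : g.bracket h y = -((2 : F) • y))
    (hxy : g.bracket x y = h)
    (hgen : ∀ S : Submodule F L, x ∈ S → y ∈ S → h ∈ S →
      (∀ a ∈ S, ∀ b ∈ S, g.bracket a b ∈ S) → S = ⊤) :
    Submodule.span F {g.bracket x x, g.bracket y y, h, x, y} = ⊤ ∧
    Module.finrank F L = 5 ∧
    g.carrier 0 = Submodule.span F {g.bracket x x, g.bracket y y, h} ∧
    g.carrier 1 = Submodule.span F {x, y} := by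
  have hyx : g.bracket y x = h := (g.bracket_comm_of_odd hy hx).trans hxy
  have hxh : g.bracket x h = -((2 : F) • x) := by rw [g.bracket_eq_neg_of_even hh hx, hhx]
  have hyh : g.bracket y h = (2 : F) • y := by rw [g.bracket_eq_neg_of_even hh hy, hhy, neg_neg]
  have hX := g.bracket_self_mem_even hx
  have hY := g.bracket_self_mem_even hy
  have hXx := g.bracket_bracket_self_self hx
  have hYy := g.bracket_bracket_self_self hy
  have hXc := g.bracket_bracket_of_odd hx hx
  have hYc := g.bracket_bracket_of_odd hy hy
  have hhX := g.bracket_bracket_self_of_eigen hh hx hhx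
  have hhY := g.bracket_bracket_self_of_eigen hh hy (hhy.trans (neg_smul _ _).symm)
  have hhh : g.bracket h h = 0 := by
    have := g.bracket_bracket_of_odd hx hy h
    rwa [hxy, hyh, hxh, map_neg, map_smul, map_smul, hxy, hyx, add_neg_cancel] at this
  generalize hXdef : g.bracket x x = X at *
  generalize hYdef : g.bracket y y = Y at *
  have hxX : g.bracket x X = 0 := by rw [g.bracket_eq_neg_of_even hX hx, hXx, neg_zero]
  have hyY : g.bracket y Y = 0 := by rw [g.bracket_eq_neg_of_even hY hy, hYy, neg_zero]
  have hXy : g.bracket X y = (-4 : F) • x := by rw [hXc, hxy, hxh]; module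
  have hYx : g.bracket Y x = (4 : F) • y := by rw [hYc, hyx, hyh]; module
  have hyX : g.bracket y X = (4 : F) • x := by
    rw [g.bracket_eq_neg_of_even hX hy, hXy]; module
  have hxY : g.bracket x Y = (-4 : F) • y := by
    rw [g.bracket_eq_neg_of_even hY hx, hYx]; module
  have hXX : g.bracket X X = 0 := by rw [hXc, hxX, map_zero, add_zero]
  have hYY : g.bracket Y Y = 0 := by rw [hYc, hyY, map_zero, add_zero]
  have hXY : g.bracket X Y = (-8 : F) • h := by rw [hXc, hxY, map_smul, hxy]; module
  have hYX : g.bracket Y X = (8 : F) • h := by rw [hYc, hyX, map_smul, hyx]; module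
  have hXh : g.bracket X h = -((2 * 2 : F) • X) := by rw [g.bracket_eq_neg_of_even hh hX, hhX]
  have hYh : g.bracket Y h = -((2 * -2 : F) • Y) := by rw [g.bracket_eq_neg_of_even hh hY, hhY]
  have hX0 : X ≠ 0 := by
    rintro rfl
    rw [map_zero, LinearMap.zero_apply] at hXy
    exact smul_ne_zero (by norm_num) hx0 hXy.symm
  have hY0 : Y ≠ 0 := by
    rintro rfl
    rw [map_zero, LinearMap.zero_apply] at hYx
    exact smul_ne_zero (by norm_num) hy0 hYx.symm
  have hspan : Submodule.span F {X, Y, h, x, y} = ⊤ := by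
    have mX : X ∈ Submodule.span F {X, Y, h, x, y} := Submodule.subset_span (by simp)
    have mY : Y ∈ Submodule.span F {X, Y, h, x, y} := Submodule.subset_span (by simp)
    have mh : h ∈ Submodule.span F {X, Y, h, x, y} := Submodule.subset_span (by simp)
    have mx : x ∈ Submodule.span F {X, Y, h, x, y} := Submodule.subset_span (by simp)
    have my : y ∈ Submodule.span F {X, Y, h, x, y} := Submodule.subset_span (by simp)
    clear hXc hYc
    refine hgen _ mx my mh (Submodule.map₂_le.mp ?_)
    rw [Submodule.map₂_span_span, Submodule.span_le]
    rintro _ ⟨a, rfl | rfl | rfl | rfl | rfl, b, rfl | rfl | rfl | rfl | rfl, rfl⟩ <;>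
      simp only [*, SetLike.mem_coe, neg_mem_iff, Submodule.smul_mem, Submodule.zero_mem]
  have hli : LinearIndependent F ![X, Y, h, x, y] := by
    refine Module.End.eigenvectors_linearIndependent' (g.bracket h)
      (![4, -4, 0, 2, -2] : Fin 5 → F) ?_ _ ?_
    · intro i j hij
      fin_cases i <;> fin_cases j <;> first | rfl | (norm_num at hij)
    · intro i
      rw [Module.End.hasEigenvector_iff, Module.End.mem_eigenspace_iff]
      fin_cases i
      · exact ⟨by simp [hhX]; norm_num, hX0⟩
      · exact ⟨by simp [hhY]; norm_num, hY0⟩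
      · exact ⟨by simp [hhh], hh0⟩
      · exact ⟨by simp [hhx], hx0⟩
      · exact ⟨by simp [hhy], hy0⟩
  refine ⟨hspan, ?_, g.isCompl.eq_and_eq_of_le_of_sup_eq_top ?_ ?_ ?_⟩
  · have hcard := finrank_span_eq_card hli
    have hrange : Set.range ![X, Y, h, x, y] = {X, Y, h, x, y} := by
      simp only [Matrix.range_cons, Matrix.range_empty, Set.union_empty, Set.singleton_union]
    rwa [hrange, hspan, finrank_top, Fintype.card_fin] at hcard
  · rw [Submodule.span_le]
    rintro _ (rfl | rfl | rfl) <;> assumption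
  · rw [Submodule.span_le]
    rintro _ (rfl | rfl) <;> assumption
  · rw [← Submodule.span_union, ← hspan]
    congr 1
    ext a
    simp only [Set.mem_union, Set.mem_insert_iff, Set.mem_singleton_iff, or_assoc]
end

section
/- Let (e,f,h) be an osp-triple for a Lie superalgebra g over a field F of characteristic zero, and let (V,·) be a g-module. Suppose λ ∈ F with λ ≠ -2 and u ∈ V is a homogeneous element with h·u = λu and [e,e]·u = 0. Then the g₀-submodule of V generated by f·u (the smallest subspace containing f·u that is stable under the action of g₀ = span_F{[e,e],[f,f],h}) equals T := Σ_{k≥0} F·(f^{2k}·(e·u)) + Σ_{k≥0} F·(f^{2k+1}·(f·(e·u) - (λ+2)u)), where f^k denotes the k-fold application of the action of f. -/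
variable {F : Type} [Field F] {L : Type} [AddCommGroup L] [Module F L]

variable {V : Type} [AddCommGroup V] [Module F V]

namespace LieSuperModule

variable {g : LieSuperAlgebra F L} (M : LieSuperModule g V)

theorem act_bracket_odd_odd {x y : L} (hx : x ∈ g.carrier 1) (hy : y ∈ g.carrier 1) (v : V) :
    M.act (g.bracket x y) v = M.act x (M.act y v) + M.act y (M.act x v) := by
  simpa [ZMod.val_one] using M.bracket_act 1 1 x hx y hy v

theorem act_bracket_even_odd {x y : L} (hx : x ∈ g.carrier 0) (hy : y ∈ g.carrier 1) (v : V) :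
    M.act (g.bracket x y) v = M.act x (M.act y v) - M.act y (M.act x v) := by
  simpa using M.bracket_act 0 1 x hx y hy v

theorem act_bracket_self {x : L} (hx : x ∈ g.carrier 1) (v : V) :
    M.act (g.bracket x x) v = (2 : F) • M.act x (M.act x v) := by
  rw [M.act_bracket_odd_odd hx hx, two_smul]

variable {e f h : L}

theorem act_e_act_f (ht : g.IsOspTriple e f h) (v : V) :
    M.act e (M.act f v) = M.act h v - M.act f (M.act e v) := by
  rw [← ht.ef, M.act_bracket_odd_odd ht.e_mem ht.f_mem, add_sub_cancel_right]

theorem act_h_act_e (ht : g.IsOspTriple e f h) {μ : F} {v : V} (hv : M.act h v = μ • v) :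
    M.act h (M.act e v) = (μ + 2) • M.act e v := by
  have := M.act_bracket_even_odd ht.h_mem ht.e_mem v
  rw [ht.he, hv, map_smul, map_smul, LinearMap.smul_apply, eq_sub_iff_add_eq] at this
  rw [← this, add_smul, add_comm]

theorem act_h_act_f (ht : g.IsOspTriple e f h) {μ : F} {v : V} (hv : M.act h v = μ • v) :
    M.act h (M.act f v) = (μ - 2) • M.act f v := by
  have := M.act_bracket_even_odd ht.h_mem ht.f_mem v
  rw [ht.hf, hv, map_neg, map_smul, map_smul, LinearMap.neg_apply, LinearMap.smul_apply,
    eq_sub_iff_add_eq] at this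
  rw [← this, sub_smul, neg_add_eq_sub]

theorem act_h_pow_act_f (ht : g.IsOspTriple e f h) {μ : F} {v : V} (hv : M.act h v = μ • v)
    (n : ℕ) : M.act h ((M.act f ^ n) v) = (μ - 2 * n) • (M.act f ^ n) v := by
  induction n with
  | zero => simpa using hv
  | succ n ih =>
    rw [pow_succ', Module.End.mul_apply, M.act_h_act_f ht ih]
    congr 1
    push_cast
    ring

theorem act_e_pow_act_f_odd_of_even (ht : g.IsOspTriple e f h) {μ : F} {v : V}
    (hv : M.act h v = μ • v) (k : ℕ)
    (hk : M.act f (M.act e ((M.act f ^ (2 * k)) v)) = (-(2 * k) : F) • (M.act f ^ (2 * k)) v) :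
    M.act e ((M.act f ^ (2 * k + 1)) v) = (μ - 2 * k) • (M.act f ^ (2 * k)) v := by
  rw [pow_succ', Module.End.mul_apply, M.act_e_act_f ht, M.act_h_pow_act_f ht hv, hk, ← sub_smul]
  congr 1
  push_cast
  ring

theorem act_f_act_e_pow_act_f_even (ht : g.IsOspTriple e f h) {μ : F} {v : V}
    (hv : M.act h v = μ • v) (he : M.act e v = 0) (k : ℕ) :
    M.act f (M.act e ((M.act f ^ (2 * k)) v)) = (-(2 * k) : F) • (M.act f ^ (2 * k)) v := by
  induction k with
  | zero => simp [he]
  | succ k ih =>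
    rw [Nat.mul_succ, pow_succ' _ (2 * k + 1), Module.End.mul_apply, M.act_e_act_f ht,
      M.act_h_pow_act_f ht hv, M.act_e_pow_act_f_odd_of_even ht hv k ih, map_sub, map_smul,
      map_smul, map_smul, ← Module.End.mul_apply (M.act f) (M.act f ^ (2 * k)), ← pow_succ',
      ← sub_smul]
    congr 1
    push_cast
    ring

theorem act_e_pow_act_f_odd (ht : g.IsOspTriple e f h) {μ : F} {v : V}
    (hv : M.act h v = μ • v) (he : M.act e v = 0) (k : ℕ) :
    M.act e ((M.act f ^ (2 * k + 1)) v) = (μ - 2 * k) • (M.act f ^ (2 * k)) v :=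
  M.act_e_pow_act_f_odd_of_even ht hv k (M.act_f_act_e_pow_act_f_even ht hv he k)

theorem act_e_pow_act_f_even (ht : g.IsOspTriple e f h) {μ : F} {v : V}
    (hv : M.act h v = μ • v) (he : M.act e v = 0) (k : ℕ) :
    M.act e ((M.act f ^ (2 * k + 2)) v) = (-(2 * (k + 1)) : F) • (M.act f ^ (2 * k + 1)) v := by
  rw [pow_succ' _ (2 * k + 1), Module.End.mul_apply, M.act_e_act_f ht,
    M.act_h_pow_act_f ht hv, M.act_e_pow_act_f_odd ht hv he, map_smul,
    ← Module.End.mul_apply (M.act f) (M.act f ^ (2 * k)), ← pow_succ', ← sub_smul]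
  congr 1
  push_cast
  ring

theorem act_e_act_e_pow_act_f (ht : g.IsOspTriple e f h) {μ : F} {v : V}
    (hv : M.act h v = μ • v) (he : M.act e v = 0) (n : ℕ) :
    ∃ c : F, M.act e (M.act e ((M.act f ^ (n + 2)) v)) = c • (M.act f ^ n) v := by
  obtain ⟨k, rfl | rfl⟩ := n.even_or_odd'
  · rw [M.act_e_pow_act_f_even ht hv he, map_smul, M.act_e_pow_act_f_odd ht hv he, smul_smul]
    exact ⟨_, rfl⟩
  · rw [show 2 * k + 1 + 2 = 2 * (k + 1) + 1 by ring, M.act_e_pow_act_f_odd ht hv he, map_smul,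
      Nat.mul_succ, M.act_e_pow_act_f_even ht hv he, smul_smul]
    exact ⟨_, rfl⟩

end LieSuperModule

/-- description of the `g₀`-submodule generated by `f·u` when `h·u = λu`,
`[e,e]·u = 0` and `λ ≠ -2`. -/
theorem osp_g0_submodule_generated_by_fu
    {F : Type} [Field F] [CharZero F] {L : Type} [AddCommGroup L] [Module F L]
    (g : LieSuperAlgebra F L) (e f h : L) (ht : g.IsOspTriple e f h)
    {V : Type} [AddCommGroup V] [Module F V] (M : LieSuperModule g V)
    (lam : F) (hlam : lam ≠ -2)
    (u : V) (p : ZMod 2) (hu : u ∈ M.carrier p)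
    (hu1 : M.act h u = lam • u) (hu2 : M.act (g.bracket e e) u = 0) :
    sInf {S : Submodule F V | M.act f u ∈ S ∧
        ∀ v ∈ S, M.act (g.bracket e e) v ∈ S ∧ M.act (g.bracket f f) v ∈ S ∧ M.act h v ∈ S}
      = Submodule.span F
          ((Set.range fun k : ℕ => (M.act f ^ (2 * k)) (M.act e u)) ∪
           (Set.range fun k : ℕ =>
              (M.act f ^ (2 * k + 1)) (M.act f (M.act e u) - (lam + 2) • u))) := by
  set a := M.act e u with ha
  set w := M.act f a - (lam + 2) • u with hw
  have hea : M.act e a = 0 := by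
    rw [M.act_bracket_self ht.e_mem] at hu2
    simpa using hu2
  have hha : M.act h a = (lam + 2) • a := M.act_h_act_e ht hu1
  have hhw : M.act h w = lam • w := by
    rw [hw, map_sub, M.act_h_act_f ht hha, map_smul, hu1, smul_sub, add_sub_cancel_right,
      smul_comm lam]
  have hew : M.act e w = 0 := by
    rw [hw, map_sub, M.act_e_act_f ht, hea, hha, map_smul, map_zero, sub_zero, ← ha, sub_self]
  have hfw : M.act f w = M.act f (M.act f a) - (lam + 2) • M.act f u := by
    rw [hw, map_sub, map_smul]
  have hlam' : lam + 2 ≠ 0 := fun h0 => hlam (eq_neg_of_add_eq_zero_left h0)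
  have hff (n : ℕ) (v : V) : M.act f (M.act f ((M.act f ^ n) v)) = (M.act f ^ (n + 2)) v := by
    rw [pow_succ', pow_succ', Module.End.mul_apply, Module.End.mul_apply]
  apply le_antisymm
  · set T : Submodule F V := Submodule.span F _
    have haT (k : ℕ) : (M.act f ^ (2 * k)) a ∈ T := Submodule.subset_span (.inl ⟨k, rfl⟩)
    have hwT (k : ℕ) : (M.act f ^ (2 * k + 1)) w ∈ T := Submodule.subset_span (.inr ⟨k, rfl⟩)
    refine sInf_le ⟨?_, fun v hv => ?_⟩
    · have : M.act f u = (lam + 2)⁻¹ • (M.act f (M.act f a) - M.act f w) := by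
        rw [hfw, sub_sub_cancel, inv_smul_smul₀ hlam']
      rw [this]
      refine T.smul_mem _ (T.sub_mem ?_ ?_)
      · simpa [pow_two] using haT 1
      · simpa using hwT 0
    · rw [M.act_bracket_self ht.e_mem, M.act_bracket_self ht.f_mem]
      suffices H : T ≤ T.comap (M.act e ∘ₗ M.act e) ⊓ T.comap (M.act f ∘ₗ M.act f) ⊓
          T.comap (M.act h) by
        obtain ⟨⟨h1, h2⟩, h3⟩ := H hv
        exact ⟨T.smul_mem _ h1, T.smul_mem _ h2, h3⟩
      refine Submodule.span_le.2 ?_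
      rintro _ (⟨k, rfl⟩ | ⟨k, rfl⟩)
      · refine ⟨⟨?_, ?_⟩, ?_⟩
        · change M.act e (M.act e ((M.act f ^ (2 * k)) a)) ∈ T
          cases k with
          | zero => simp [hea]
          | succ k =>
            obtain ⟨c, hc⟩ := M.act_e_act_e_pow_act_f ht hha hea (2 * k)
            rw [Nat.mul_succ, hc]
            exact T.smul_mem _ (haT k)
        · change M.act f (M.act f ((M.act f ^ (2 * k)) a)) ∈ T
          rw [hff]
          exact haT (k + 1)
        · change M.act h ((M.act f ^ (2 * k)) a) ∈ T
          rw [M.act_h_pow_act_f ht hha]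
          exact T.smul_mem _ (haT k)
      · refine ⟨⟨?_, ?_⟩, ?_⟩
        · change M.act e (M.act e ((M.act f ^ (2 * k + 1)) w)) ∈ T
          cases k with
          | zero => simp [M.act_e_act_f ht, hew, hhw]
          | succ k =>
            obtain ⟨c, hc⟩ := M.act_e_act_e_pow_act_f ht hhw hew (2 * k + 1)
            rw [show 2 * (k + 1) + 1 = 2 * k + 1 + 2 by ring, hc]
            exact T.smul_mem _ (hwT k)
        · change M.act f (M.act f ((M.act f ^ (2 * k + 1)) w)) ∈ T
          rw [hff]
          exact hwT (k + 1)
        · change M.act h ((M.act f ^ (2 * k + 1)) w) ∈ T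
          rw [M.act_h_pow_act_f ht hhw]
          exact T.smul_mem _ (hwT k)
  · refine le_sInf fun S hS => ?_
    obtain ⟨hfu, hS⟩ := hS
    have hFF {v : V} (hv : v ∈ S) : M.act f (M.act f v) ∈ S := by
      have := (hS v hv).2.1
      rwa [M.act_bracket_self ht.f_mem, S.smul_mem_iff two_ne_zero] at this
    have hpow {n : ℕ} {v : V} (hv : (M.act f ^ n) v ∈ S) (k : ℕ) :
        (M.act f ^ (2 * k + n)) v ∈ S := by
      induction k with
      | zero => simpa using hv
      | succ k ih =>
        rw [show 2 * (k + 1) + n = 2 * k + n + 2 by ring, ← hff]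
        exact hFF ih
    have haS : a ∈ S := by
      have hee : M.act e (M.act e (M.act f u)) = (-2 : F) • a := by
        rw [M.act_e_act_f ht, hu1, map_sub, map_smul, ← ha, M.act_e_act_f ht, hea, hha, map_zero,
          sub_zero, ← sub_smul]
        congr 1
        ring
      have := (hS _ hfu).1
      rwa [M.act_bracket_self ht.e_mem, S.smul_mem_iff two_ne_zero, hee,
        S.smul_mem_iff (neg_ne_zero.2 two_ne_zero)] at this
    have hwS : M.act f w ∈ S := hfw ▸ S.sub_mem (hFF haS) (S.smul_mem _ hfu)
    refine Submodule.span_le.2 ?_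
    rintro _ (⟨k, rfl⟩ | ⟨k, rfl⟩)
    · exact hpow (n := 0) (by simpa using haS) k
    · exact hpow (n := 1) (by simpa using hwS) k
end

section
/- Let (e,f,h) be an osp-triple for a Lie superalgebra g over a field F of characteristic zero, and let (V,·) be a finite-dimensional g-module with corresponding representation π. Then π(h) is a diagonalizable endomorphism of V, every eigenvalue of π(h) is of the form n·1_F for an even integer n, and for each eigenvalue λ of π(h), -λ is also an eigenvalue of π(h). -/
variable {F : Type} [Field F] {L : Type} [AddCommGroup L] [Module F L]

variable {V : Type} [AddCommGroup V] [Module F V]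

namespace Module.End

variable {F V ι : Type*} [Field F] [AddCommGroup V] [Module F V]

theorem apply_mem_iSup_maxGenEigenspace {T g : Module.End F V} (hg : Commute T g) (c : ι → F)
    {v : V} (hv : v ∈ ⨆ i, T.maxGenEigenspace (c i)) : g v ∈ ⨆ i, T.maxGenEigenspace (c i) := by
  refine (iSup_le fun i => ?_ : _ ≤ (⨆ i, T.maxGenEigenspace (c i)).comap g) hv
  exact fun w hw => Submodule.mem_iSup_of_mem i (mapsTo_maxGenEigenspace_of_comm hg _ hw)

theorem exists_sub_smul_eq_of_mem_maxGenEigenspace [FiniteDimensional F V]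
    (T : Module.End F V) {a b : F} (hab : a ≠ b) {w : V} (hw : w ∈ T.maxGenEigenspace b) :
    ∃ u ∈ T.maxGenEigenspace b, T u - a • u = w := by
  have hmaps : Set.MapsTo (T - algebraMap F (Module.End F V) a)
      (T.maxGenEigenspace b) (T.maxGenEigenspace b) :=
    mapsTo_maxGenEigenspace_of_comm
      ((Commute.refl T).sub_right (Algebra.commute_algebraMap_right a T)) b
  have hinj : Function.Injective ((T - algebraMap F (Module.End F V) a).restrict hmaps) := by
    rw [injective_iff_map_eq_zero]
    rintro ⟨u, hu⟩ h0
    have h1 : T u - a • u = 0 := congrArg Subtype.val h0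
    exact Subtype.ext <| Submodule.disjoint_def.1 (disjoint_genEigenspace T hab ⊤ ⊤) u
      (eigenspace_le_maxGenEigenspace (mem_eigenspace_iff.2 (sub_eq_zero.1 h1))) hu
  obtain ⟨u, hu⟩ := LinearMap.surjective_of_injective hinj ⟨w, hw⟩
  exact ⟨u, u.2, congrArg Subtype.val hu⟩

theorem mem_maxGenEigenspace_of_sub_smul_mem {T : Module.End F V} {a : F} {v : V}
    (hv : T v - a • v ∈ T.maxGenEigenspace a) : v ∈ T.maxGenEigenspace a := by
  obtain ⟨k, hk⟩ := (mem_maxGenEigenspace T a _).1 hv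
  refine (mem_maxGenEigenspace T a _).2 ⟨k + 1, ?_⟩
  rwa [pow_succ]

theorem mem_iSup_maxGenEigenspace_of_sub_smul_mem [FiniteDimensional F V]
    {T : Module.End F V} {c : ι → F} (i : ι) {v : V}
    (hv : T v - c i • v ∈ ⨆ j, T.maxGenEigenspace (c j)) :
    v ∈ ⨆ j, T.maxGenEigenspace (c j) := by
  have key (w : V) (hw : w ∈ ⨆ j, T.maxGenEigenspace (c j)) :
      ∃ u ∈ ⨆ j, T.maxGenEigenspace (c j),
        w - (T u - c i • u) ∈ T.maxGenEigenspace (c i) := by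
    induction hw using Submodule.iSup_induction' with
    | mem j w hw =>
      by_cases hij : c i = c j
      · exact ⟨0, Submodule.zero_mem _, by simpa [hij] using hw⟩
      · obtain ⟨u, hu, rfl⟩ := exists_sub_smul_eq_of_mem_maxGenEigenspace T hij hw
        exact ⟨u, Submodule.mem_iSup_of_mem j hu, by simp⟩
    | zero => exact ⟨0, Submodule.zero_mem _, by simp⟩
    | add x y _ _ hx hy =>
      obtain ⟨u, hu, hux⟩ := hx
      obtain ⟨u', hu', huy⟩ := hy
      refine ⟨u + u', Submodule.add_mem _ hu hu', ?_⟩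
      convert Submodule.add_mem _ hux huy using 1
      simp only [map_add]
      module
  obtain ⟨u, hu, huv⟩ := key _ hv
  rw [← sub_add_cancel v u]
  refine Submodule.add_mem _ (Submodule.mem_iSup_of_mem i
    (mem_maxGenEigenspace_of_sub_smul_mem ?_)) hu
  convert huv using 1
  simp only [map_sub]
  module

theorem exists_sub_smul_eq_of_mem_iSup_eigenspace {T : Module.End F V} {c : ι → F} {a : F}
    (ha : ∀ i, c i ≠ a) {w : V} (hw : w ∈ ⨆ i, T.eigenspace (c i)) :
    ∃ u ∈ ⨆ i, T.eigenspace (c i), T u - a • u = w := by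
  induction hw using Submodule.iSup_induction' with
  | mem i w hw =>
    refine ⟨(c i - a)⁻¹ • w, Submodule.smul_mem _ _ (Submodule.mem_iSup_of_mem i hw), ?_⟩
    rw [map_smul, mem_eigenspace_iff.1 hw, smul_comm a, ← smul_sub, ← sub_smul,
      inv_smul_smul₀ (sub_ne_zero.2 (ha i))]
  | zero => exact ⟨0, Submodule.zero_mem _, by simp⟩
  | add x y _ _ hx hy =>
    obtain ⟨u, hu, rfl⟩ := hx
    obtain ⟨u', hu', rfl⟩ := hy
    refine ⟨u + u', Submodule.add_mem _ hu hu', ?_⟩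
    simp only [map_add]
    module

end Module.End

/-- Three endomorphisms satisfying the defining relations of `osp(1,2)`. -/
structure IsOspAction {F V : Type*} [Field F] [AddCommGroup V] [Module F V]
    (e f h : Module.End F V) : Prop where
  he : ∀ v, h (e v) = e (h v) + (2 : F) • e v
  hf : ∀ v, h (f v) = f (h v) - (2 : F) • f v
  ef : ∀ v, e (f v) = h v - f (e v)

namespace IsOspAction

variable {F V : Type*} [Field F] [AddCommGroup V] [Module F V] {e f h : Module.End F V}

/-- The relations are preserved by exchanging the roles of `e` and `f`. -/
theorem swap (H : IsOspAction e f h) : IsOspAction f (-e) (-h) where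
  he v := by simp only [LinearMap.neg_apply, map_neg, H.hf]; module
  hf v := by simp only [LinearMap.neg_apply, map_neg, H.he]; module
  ef v := by simp only [LinearMap.neg_apply, map_neg, H.ef]; module

theorem h_e_pow (H : IsOspAction e f h) (k : ℕ) (v : V) :
    h ((e ^ k) v) = (e ^ k) (h v) + (2 * k : F) • (e ^ k) v := by
  induction k with
  | zero => simp
  | succ k ih =>
    simp only [pow_succ', Module.End.mul_apply, H.he, ih, map_add, map_smul]
    push_cast
    module

theorem h_f_pow (H : IsOspAction e f h) (k : ℕ) (v : V) :
    h ((f ^ k) v) = (f ^ k) (h v) - (2 * k : F) • (f ^ k) v := by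
  have := H.swap.h_e_pow k v
  simp only [LinearMap.neg_apply, map_neg] at this
  rw [← neg_inj, this]
  module

theorem e_f_pow (H : IsOspAction e f h) (k : ℕ) (v : V) :
    e ((f ^ (2 * k + 1)) v) =
        (f ^ (2 * k)) (h v) - (2 * k : F) • (f ^ (2 * k)) v - (f ^ (2 * k + 1)) (e v) ∧
      e ((f ^ (2 * k + 2)) v) =
        (f ^ (2 * k + 2)) (e v) - (2 * k + 2 : F) • (f ^ (2 * k + 1)) v := by
  have hp (n : ℕ) (w : V) : f ((f ^ n) w) = (f ^ (n + 1)) w := by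
    rw [pow_succ', Module.End.mul_apply]
  have odd_even (k : ℕ) (ih : e ((f ^ (2 * k + 1)) v) =
        (f ^ (2 * k)) (h v) - (2 * k : F) • (f ^ (2 * k)) v - (f ^ (2 * k + 1)) (e v)) :
      e ((f ^ (2 * k + 2)) v) =
        (f ^ (2 * k + 2)) (e v) - (2 * k + 2 : F) • (f ^ (2 * k + 1)) v := by
    have hh := H.h_f_pow (2 * k + 1) v
    rw [← hp (2 * k + 1) v, H.ef, ih, hh]
    simp only [map_sub, map_smul, hp, add_assoc, Nat.reduceAdd]
    push_cast
    module
  induction k with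
  | zero =>
    have h0 := H.ef v
    refine ⟨by simpa using h0, odd_even 0 (by simpa using h0)⟩
  | succ k ih =>
    refine ⟨?_, odd_even (k + 1) ?_⟩ <;>
    · have hh := H.h_f_pow (2 * k + 2) v
      rw [show 2 * (k + 1) + 1 = (2 * k + 2) + 1 by ring, ← hp (2 * k + 2) v, H.ef, ih.2, hh]
      simp only [map_sub, map_smul, hp, mul_add, mul_one,
        add_assoc, Nat.reduceAdd]
      push_cast
      module

theorem e_e_f_pow (H : IsOspAction e f h) (k : ℕ) (v : V) :
    e (e ((f ^ (2 * (k + 1))) v)) = e ((f ^ (2 * (k + 1))) (e v))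
      - (2 * k + 2 : F) • ((f ^ (2 * k)) (h v - (2 * k : F) • v) - (f ^ (2 * k + 1)) (e v)) := by
  rw [show 2 * (k + 1) = 2 * k + 2 by ring, (H.e_f_pow k v).2, map_sub, map_smul,
    (H.e_f_pow k v).1, map_sub, map_smul]

theorem isNilpotent_e [CharZero F] [FiniteDimensional F V] (H : IsOspAction e f h) :
    ∃ n : ℕ, e ^ n = 0 := by
  by_contra! hne
  let ad : Module.End F (Module.End F V) := LinearMap.mulLeft F h - LinearMap.mulRight F h
  have hev (k : ℕ) : ad.HasEigenvector (2 * k : F) (e ^ k) := by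
    refine ⟨Module.End.mem_eigenspace_iff.2 ?_, hne k⟩
    ext v
    simp only [ad, LinearMap.sub_apply, LinearMap.mulLeft_apply, LinearMap.mulRight_apply,
      Module.End.mul_apply, LinearMap.smul_apply, H.h_e_pow]
    module
  have hinj : Function.Injective fun k : ℕ => (2 * k : F) := fun a b hab => by
    simpa using hab
  have := (Module.End.eigenvectors_linearIndependent' ad _ hinj _ hev).finite
  exact not_finite ℕ

theorem isNilpotent_f [CharZero F] [FiniteDimensional F V] (H : IsOspAction e f h) :
    ∃ n : ℕ, f ^ n = 0 :=
  H.swap.isNilpotent_e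

/-- The weight of a vector annihilated by `e` is an even natural number. -/
theorem weight_of_e_eq_zero [CharZero F] [FiniteDimensional F V] (H : IsOspAction e f h)
    {v : V} (hv : v ≠ 0) (hev : e v = 0) {μ : F} (hμ : h v = μ • v) :
    ∃ i : ℕ, μ = 2 * i := by
  obtain ⟨n, hn⟩ := H.isNilpotent_f
  have key (N : ℕ) (h0 : (f ^ (2 * N)) v = 0) : ∃ i : ℕ, μ = 2 * i := by
    induction N with
    | zero => exact absurd (by simpa using h0) hv
    | succ N ih =>
      have h1 := H.e_e_f_pow N v
      rw [h0, hev, hμ, ← sub_smul] at h1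
      simp only [map_zero, map_smul, sub_zero, zero_sub, zero_eq_neg, smul_eq_zero] at h1
      rcases h1 with h1 | h1 | h1
      · exact absurd h1 (by norm_cast)
      · exact ⟨N, sub_eq_zero.1 h1⟩
      · exact ih h1
  exact key n (by rw [two_mul, pow_add, hn]; simp)

/-- A vector of weight `2 * i` annihilated by `e` generates vectors of every even weight
between `2 * i` and `-2 * i`. -/
theorem f_pow_ne_zero [CharZero F] (H : IsOspAction e f h)
    {v : V} (hv : v ≠ 0) (hev : e v = 0) {i : ℕ} (hi : h v = (2 * i : F) • v) {j : ℕ}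
    (hj : j ≤ 2 * i) : (f ^ j) v ≠ 0 := by
  induction j with
  | zero => simpa using hv
  | succ j ih =>
    intro h0
    have ih := ih (by omega)
    obtain ⟨k, hk | hk⟩ := Nat.even_or_odd' j
    · have h1 := (H.e_f_pow k v).1
      rw [← hk, h0, hev, hi, map_smul, ← sub_smul] at h1
      simp only [map_zero, sub_zero] at h1
      have : i = k := by simpa [sub_eq_zero, ih] using h1.symm
      omega
    · have h1 := (H.e_f_pow k v).2
      rw [show 2 * k + 2 = j + 1 by omega, ← hk, h0, hev] at h1
      simp only [map_zero, zero_sub, zero_eq_neg, smul_eq_zero, ih, or_false] at h1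
      exact absurd h1 (by norm_cast)

/-- Applying `e` to a weight vector often enough yields a weight vector annihilated by `e`. -/
theorem exists_e_eq_zero [CharZero F] [FiniteDimensional F V] (H : IsOspAction e f h)
    {v : V} (hv : v ≠ 0) {μ : F} (hμ : h v = μ • v) :
    ∃ (w : V) (i k : ℕ), w ≠ 0 ∧ e w = 0 ∧ h w = (2 * i : F) • w ∧ μ = 2 * i - 2 * k := by
  classical
  obtain ⟨n, hn⟩ := H.isNilpotent_e
  have hex : ∃ n, (e ^ n) v = 0 := ⟨n, by simp [hn]⟩
  obtain ⟨k, hk⟩ : ∃ k, Nat.find hex = k + 1 :=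
    Nat.exists_eq_succ_of_ne_zero fun h0 => hv (by simpa [h0] using Nat.find_spec hex)
  have hw : (e ^ k) v ≠ 0 := Nat.find_min hex (by omega)
  have hew : e ((e ^ k) v) = 0 := by
    rw [← Module.End.mul_apply, ← pow_succ', ← hk]
    exact Nat.find_spec hex
  have hhw : h ((e ^ k) v) = (μ + 2 * k) • (e ^ k) v := by
    rw [H.h_e_pow, hμ, map_smul, add_smul]
  obtain ⟨i, hi⟩ := H.weight_of_e_eq_zero hw hew hhw
  exact ⟨_, i, k, hw, hew, by rw [hhw, hi], by rw [← hi]; ring⟩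

theorem exists_int_of_hasEigenvalue [CharZero F] [FiniteDimensional F V]
    (H : IsOspAction e f h) {μ : F} (hμ : h.HasEigenvalue μ) :
    ∃ n : ℤ, μ = 2 * n := by
  obtain ⟨v, hv⟩ := hμ.exists_hasEigenvector
  obtain ⟨-, i, k, -, -, -, hik⟩ := H.exists_e_eq_zero hv.2 hv.apply_eq_smul
  exact ⟨i - k, by rw [hik]; push_cast; ring⟩

theorem hasEigenvalue_neg_of_nat [CharZero F] [FiniteDimensional F V]
    (H : IsOspAction e f h) {n : ℕ} (hμ : h.HasEigenvalue (2 * n : F)) :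
    h.HasEigenvalue (-(2 * n : F)) := by
  obtain ⟨v, hv⟩ := hμ.exists_hasEigenvector
  obtain ⟨w, i, k, hw, hew, hhw, hik⟩ := H.exists_e_eq_zero hv.2 hv.apply_eq_smul
  have hi : i = n + k := by
    have : (2 * (n + k : ℕ) : F) = 2 * i := by push_cast; linear_combination hik
    exact_mod_cast (mul_left_cancel₀ two_ne_zero this).symm
  refine Module.End.hasEigenvalue_of_hasEigenvector (x := (f ^ (i + n)) w)
    ⟨Module.End.mem_eigenspace_iff.2 ?_, H.f_pow_ne_zero hw hew hhw (by omega)⟩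
  rw [H.h_f_pow, hhw, map_smul, ← sub_smul]
  push_cast
  congr 1
  ring

theorem hasEigenvalue_neg [CharZero F] [FiniteDimensional F V]
    (H : IsOspAction e f h) {μ : F} (hμ : h.HasEigenvalue μ) : h.HasEigenvalue (-μ) := by
  obtain ⟨n, rfl⟩ := H.exists_int_of_hasEigenvalue hμ
  have hneg (g : Module.End F V) (ν : F) (hν : g.HasEigenvalue ν) : (-g).HasEigenvalue (-ν) := by
    obtain ⟨v, hv⟩ := hν.exists_hasEigenvector
    exact Module.End.hasEigenvalue_of_hasEigenvector (x := v)
      ⟨Module.End.mem_eigenspace_iff.2 (by simp [hv.apply_eq_smul]), hv.2⟩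
  obtain ⟨m, rfl | rfl⟩ := n.eq_nat_or_neg
  · exact_mod_cast H.hasEigenvalue_neg_of_nat (n := m) (by exact_mod_cast hμ)
  · have := H.swap.hasEigenvalue_neg_of_nat (n := m) (by simpa using hneg h _ hμ)
    simpa using hneg _ _ this

/-- The Scasimir element, which anticommutes with `e` and `f`. -/
def scasimir (e f h : Module.End F V) : Module.End F V := h + 1 - (2 : F) • (f * e)

theorem scasimir_apply (v : V) : scasimir e f h v = h v + v - (2 : F) • f (e v) := rfl

theorem scasimir_e (H : IsOspAction e f h) (v : V) :
    scasimir e f h (e v) = -e (scasimir e f h v) := by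
  simp only [scasimir_apply, map_add, map_sub, map_smul, H.he, H.ef]
  module

theorem scasimir_f (H : IsOspAction e f h) (v : V) :
    scasimir e f h (f v) = -f (scasimir e f h v) := by
  simp only [scasimir_apply, map_add, map_sub, map_smul, H.hf, H.ef]
  module

/-- The square of the Scasimir element, which is central. -/
def casimir (e f h : Module.End F V) : Module.End F V := scasimir e f h * scasimir e f h

theorem casimir_apply (v : V) :
    casimir e f h v = scasimir e f h (scasimir e f h v) := rfl

theorem commute_casimir_e (H : IsOspAction e f h) : Commute (casimir e f h) e := by
  ext v
  simp [casimir_apply, H.scasimir_e]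

theorem commute_casimir_f (H : IsOspAction e f h) : Commute (casimir e f h) f := by
  ext v
  simp [casimir_apply, H.scasimir_f]

theorem commute_casimir_h (H : IsOspAction e f h) : Commute (casimir e f h) h := by
  have hc := (H.commute_casimir_e.mul_right H.commute_casimir_f).add_right
    (H.commute_casimir_f.mul_right H.commute_casimir_e)
  rwa [show e * f + f * e = h by ext v; simp [H.ef]] at hc

theorem casimir_sub_smul (H : IsOspAction e f h) (a : F) (v : V) :
    casimir e f h v - (a + 1) ^ 2 • v = h (h v - a • v) + (a + 2) • (h v - a • v)
      - (2 : F) • (f (h (e v)) + scasimir e f h (f (e v)) - f (e v)) := by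
  rw [casimir_apply, scasimir_apply v]
  simp only [scasimir_apply, map_add, map_sub, map_smul, H.he, H.hf]
  module

theorem sub_smul_apply_e (H : IsOspAction e f h) (a : F) (v : V) :
    e (h v - a • v) = h (e v) - (a + 2) • e v := by
  simp only [map_sub, map_smul, H.he]
  module

theorem iSup_maxGenEigenspace_casimir [CharZero F] [FiniteDimensional F V]
    (H : IsOspAction e f h) :
    ⨆ i : ℕ, (casimir e f h).maxGenEigenspace ((2 * i + 1 : F) ^ 2) = ⊤ := by
  set G := ⨆ i : ℕ, (casimir e f h).maxGenEigenspace ((2 * i + 1 : F) ^ 2) with hG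
  have stable {g : Module.End F V} (hg : Commute (casimir e f h) g) {v : V} (hv : v ∈ G) :
      g v ∈ G :=
    Module.End.apply_mem_iSup_maxGenEigenspace hg _ hv
  have he {v : V} (hv : v ∈ G) : e v ∈ G := stable H.commute_casimir_e hv
  have hf {v : V} (hv : v ∈ G) : f v ∈ G := stable H.commute_casimir_f hv
  have hh {v : V} (hv : v ∈ G) : h v ∈ G := stable H.commute_casimir_h hv
  have hfk (k : ℕ) {v : V} (hv : v ∈ G) : (f ^ k) v ∈ G :=
    stable (H.commute_casimir_f.pow_right k) hv
  have hs {v : V} (hv : v ∈ G) : scasimir e f h v ∈ G :=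
    G.sub_mem (G.add_mem (hh hv) hv) (G.smul_mem _ (hf (he hv)))
  have of_f_pow (N : ℕ) : ∀ v : V, e v ∈ G → (f ^ (2 * N)) v ∈ G → v ∈ G := by
    induction N with
    | zero => intro v _ hv; simpa using hv
    | succ N ih =>
      intro v hev hfv
      have hw : h v - (2 * N : F) • v ∈ G := by
        refine ih _ ?_ ?_
        · rw [H.sub_smul_apply_e]
          exact G.sub_mem (hh hev) (G.smul_mem _ hev)
        · have h1 := H.e_e_f_pow N v
          have h2 := G.sub_mem (he (hfk (2 * (N + 1)) hev)) (he (he hfv))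
          rw [h1, sub_sub_cancel, G.smul_mem_iff (by norm_cast)] at h2
          simpa using G.add_mem h2 (hfk (2 * N + 1) hev)
      refine Module.End.mem_iSup_maxGenEigenspace_of_sub_smul_mem
        (c := fun i : ℕ => (2 * i + 1 : F) ^ 2) N ?_
      rw [H.casimir_sub_smul (2 * N : F) v]
      exact G.sub_mem (G.add_mem (hh hw) (G.smul_mem _ hw)) (G.smul_mem _
        (G.sub_mem (G.add_mem (hf (hh hev)) (hs (hf hev))) (hf hev)))
  obtain ⟨n, hn⟩ := H.isNilpotent_f
  obtain ⟨m, hm⟩ := H.isNilpotent_e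
  have of_e_pow (k : ℕ) : ∀ v : V, (e ^ k) v ∈ G → v ∈ G := by
    induction k with
    | zero => intro v hv; simpa using hv
    | succ k ih =>
      intro v hv
      exact of_f_pow n v (ih (e v) (by rwa [pow_succ] at hv)) (by simp [two_mul, pow_add, hn])
  exact Submodule.eq_top_iff'.2 fun v => of_e_pow m v (by simp [hm])

/-- On the generalized eigenspace of the Casimir element for `(2 * i + 1) ^ 2`, the vectors
annihilated by `e` have weight `2 * i`. -/
theorem h_apply_of_mem_maxGenEigenspace [CharZero F] [FiniteDimensional F V]
    (H : IsOspAction e f h) {i : ℕ} {v : V} (hev : e v = 0)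
    (hv : v ∈ (casimir e f h).maxGenEigenspace ((2 * i + 1 : F) ^ 2)) :
    h v = (2 * i : F) • v := by
  have eq_zero (N : ℕ) (hN : N ≠ i) (w : V) (hew : e w = 0)
      (hw : w ∈ (casimir e f h).maxGenEigenspace ((2 * i + 1 : F) ^ 2))
      (hhw : h w - (2 * N : F) • w = 0) : w = 0 := by
    have h1 := H.casimir_sub_smul (2 * N : F) w
    simp only [hhw, hew, map_zero, smul_zero, add_zero, sub_zero] at h1
    refine (Submodule.disjoint_def.1 (Module.End.disjoint_genEigenspace _ ?_ ⊤ ⊤)) w hw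
      (Module.End.eigenspace_le_maxGenEigenspace
        (Module.End.mem_eigenspace_iff.2 (sub_eq_zero.1 h1)))
    norm_cast
    intro h2
    have := Nat.pow_left_injective two_ne_zero h2
    omega
  have h_sub {a : F} {w : V}
      (hw : w ∈ (casimir e f h).maxGenEigenspace ((2 * i + 1 : F) ^ 2)) :
      h w - a • w ∈ (casimir e f h).maxGenEigenspace ((2 * i + 1 : F) ^ 2) :=
    Submodule.sub_mem _ (Module.End.mapsTo_maxGenEigenspace_of_comm H.commute_casimir_h _ hw)
      (Submodule.smul_mem _ _ hw)
  have e_sub {a : F} {w : V} (hw : e w = 0) : e (h w - a • w) = 0 := by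
    simp [H.sub_smul_apply_e, hw]
  have key (N : ℕ) : ∀ w ∈ (casimir e f h).maxGenEigenspace ((2 * i + 1 : F) ^ 2),
      e w = 0 → (f ^ (2 * N)) w = 0 → h w - (2 * i : F) • w = 0 ∧ (N ≤ i → w = 0) := by
    induction N with
    | zero =>
      intro w _ _ hw
      obtain rfl : w = 0 := by simpa using hw
      simp
    | succ N ih =>
      intro w hw hew hfw
      have hf : (f ^ (2 * N)) (h w - (2 * N : F) • w) = 0 := by
        have h1 := H.e_e_f_pow N w
        rw [hfw, hew] at h1
        simp only [map_zero, sub_zero, zero_sub, zero_eq_neg, smul_eq_zero] at h1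
        exact h1.resolve_left (by norm_cast)
      obtain ⟨h1, h2⟩ := ih _ (h_sub hw) (e_sub hew) hf
      rcases lt_trichotomy N i with hNi | rfl | hNi
      · obtain rfl := eq_zero N hNi.ne w hew hw (h2 hNi.le)
        simp
      · exact ⟨h2 le_rfl, fun h3 => by omega⟩
      · refine ⟨eq_zero N hNi.ne' _ (e_sub hew) (h_sub hw) ?_, fun h3 => by omega⟩
        rw [← h1]
        simp only [map_sub, map_smul]
        module
  obtain ⟨n, hn⟩ := H.isNilpotent_f
  exact sub_eq_zero.1 (key n v hv hev (by simp [two_mul, pow_add, hn])).1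

theorem iSup_eigenspace_eq_top [CharZero F] [FiniteDimensional F V]
    (H : IsOspAction e f h) : ⨆ μ : F, h.eigenspace μ = ⊤ := by
  rw [eq_top_iff, ← H.iSup_maxGenEigenspace_casimir, iSup_le_iff]
  intro i
  have key (m : ℕ) : ∀ v ∈ (casimir e f h).maxGenEigenspace ((2 * i + 1 : F) ^ 2),
      (e ^ m) v = 0 → v ∈ ⨆ j : Fin m, h.eigenspace (2 * i - 2 * (j : ℕ) : F) := by
    induction m with
    | zero =>
      intro v _ hv
      obtain rfl : v = 0 := by simpa using hv
      exact Submodule.zero_mem _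
    | succ m ih =>
      intro v hv hev
      have hek : e ((e ^ m) v) = 0 := by rwa [pow_succ'] at hev
      have hm := H.h_apply_of_mem_maxGenEigenspace hek
        (Module.End.mapsTo_maxGenEigenspace_of_comm (H.commute_casimir_e.pow_right m) _ hv)
      have hw := ih (h v - (2 * i - 2 * m : F) • v)
        (Submodule.sub_mem _ (Module.End.mapsTo_maxGenEigenspace_of_comm H.commute_casimir_h _ hv)
          (Submodule.smul_mem _ _ hv)) (by
          rw [H.h_e_pow] at hm
          rw [map_sub, map_smul, ← sub_eq_zero.2 hm]
          module)
      obtain ⟨u, hu, huv⟩ := Module.End.exists_sub_smul_eq_of_mem_iSup_eigenspace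
        (a := (2 * i - 2 * m : F)) (fun j hj => j.2.ne (by simpa using hj)) hw
      have hle : ⨆ j : Fin m, h.eigenspace (2 * i - 2 * (j : ℕ) : F) ≤
          ⨆ j : Fin (m + 1), h.eigenspace (2 * i - 2 * (j : ℕ) : F) :=
        iSup_le fun j => le_iSup_of_le j.castSucc le_rfl
      have hvu : v - u ∈ h.eigenspace (2 * i - 2 * (Fin.last m : ℕ) : F) := by
        rw [Module.End.mem_eigenspace_iff, Fin.val_last, map_sub, smul_sub,
          sub_eq_sub_iff_sub_eq_sub]
        exact huv.symm
      rw [← sub_add_cancel v u]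
      exact Submodule.add_mem _ (Submodule.mem_iSup_of_mem _ hvu) (hle hu)
  obtain ⟨m, hm⟩ := H.isNilpotent_e
  exact fun v hv => iSup_le (fun j => le_iSup h.eigenspace _) (key m v hv (by simp [hm]))

end IsOspAction

/-- The action of an `osp`-triple on a module satisfies the relations of `osp(1,2)`. -/
theorem LieSuperModule.isOspAction {F L V : Type} [Field F] [AddCommGroup L] [Module F L]
    [AddCommGroup V] [Module F V] {g : LieSuperAlgebra F L} {e f h : L}
    (ht : g.IsOspTriple e f h) (M : LieSuperModule g V) :
    IsOspAction (M.act e) (M.act f) (M.act h) where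
  he v := by
    have := M.bracket_act 0 1 h ht.h_mem e ht.e_mem v
    simp only [ht.he, ZMod.val_zero, zero_mul, pow_zero, one_smul, map_smul,
      LinearMap.smul_apply] at this
    rw [this]
    module
  hf v := by
    have := M.bracket_act 0 1 h ht.h_mem f ht.f_mem v
    simp only [ht.hf, ZMod.val_zero, zero_mul, pow_zero, one_smul, map_smul, map_neg,
      LinearMap.smul_apply, LinearMap.neg_apply] at this
    rw [sub_eq_add_neg, this]
    module
  ef v := by
    have := M.bracket_act 1 1 e ht.e_mem f ht.f_mem v
    simp only [ht.ef, ZMod.val_one, mul_one, pow_one] at this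
    rw [this]
    module


/-- for a finite-dimensional module of `osp(1,2)`, the action of `h` is
diagonalizable, with even integer eigenvalues, each occurring with its opposite. -/
theorem osp_h_diagonalizable
    {F : Type} [Field F] [CharZero F] {L : Type} [AddCommGroup L] [Module F L]
    (g : LieSuperAlgebra F L) (e f h : L) (ht : g.IsOspTriple e f h)
    {V : Type} [AddCommGroup V] [Module F V] [FiniteDimensional F V]
    (M : LieSuperModule g V) :
    (⨆ μ : F, Module.End.eigenspace (M.act h) μ) = ⊤ ∧
    (∀ μ : F, Module.End.HasEigenvalue (M.act h) μ → ∃ n : ℤ, Even n ∧ μ = (n : F)) ∧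
    (∀ μ : F, Module.End.HasEigenvalue (M.act h) μ →
      Module.End.HasEigenvalue (M.act h) (-μ)) := by
  have H := LieSuperModule.isOspAction ht M
  refine ⟨H.iSup_eigenspace_eq_top, fun μ hμ => ?_, fun μ hμ => H.hasEigenvalue_neg hμ⟩
  obtain ⟨n, rfl⟩ := H.exists_int_of_hasEigenvalue hμ
  exact ⟨2 * n, even_two_mul n, by push_cast; rfl⟩
end

section
/- Let (e,f,h) be an osp-triple for a Lie superalgebra g over a field F of characteristic zero, and let (V,·) be a nonzero finite-dimensional irreducible g-module with corresponding representation π. Then every eigenspace of π(h) is one-dimensional and there is a nonnegative even integer λ such that the set of eigenvalues of π(h) is exactly {-λ, -λ+2, …, λ-2, λ} (as elements of F). Moreover, if λ ≠ 0, then V₀ and V₁ are irreducible modules for the Lie algebra g₀ = span_F{[e,e],[f,f],h}, and there is i ∈ {0,1} such that the set of eigenvalues of (1/2)π(h) restricted to V_i is {-λ/2, -λ/2+2, …, λ/2-2, λ/2} and the set of eigenvalues of (1/2)π(h) restricted to V_{i+1} is {-λ/2+1, -λ/2+3, …, λ/2-3, λ/2-1}. -/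
variable {F : Type} [Field F] {L : Type} [AddCommGroup L] [Module F L]

variable {V : Type} [AddCommGroup V] [Module F V]

section Operators

variable {A B H : Module.End F V}

/-- A raising operator for `H` on a finite-dimensional space is nilpotent. -/
theorem exists_pow_eq_zero_of_commutator [CharZero F] [FiniteDimensional F V]
    (hA : ∀ v, H (A v) = A (H v) + (2 : F) • A v) : ∃ n : ℕ, A ^ n = 0 := by
  by_contra! hne
  have hcomm : ∀ n : ℕ, H * A ^ n = A ^ n * H + (2 * n : F) • A ^ n := by
    intro n
    induction n with
    | zero => simp
    | succ n ih =>
      have hA' : H * A = A * H + (2 : F) • A := LinearMap.ext hA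
      rw [pow_succ, ← mul_assoc, ih, add_mul, mul_assoc, hA']
      simp only [mul_add, mul_assoc, mul_smul_comm, smul_mul_assoc, Nat.cast_succ]
      module
  let D : Module.End F (Module.End F V) := LinearMap.mulLeft F H - LinearMap.mulRight F H
  have hli : LinearIndependent F (fun n : ℕ => A ^ n) := by
    refine Module.End.eigenvectors_linearIndependent' D (fun n : ℕ => (2 * n : F)) ?_ _ ?_
    · intro a b hab
      simpa using hab
    · intro n
      refine ⟨?_, hne n⟩
      rw [Module.End.mem_eigenspace_iff]
      simp [D, hcomm n]
  exact not_finite_iff_infinite.mpr inferInstance (hli.finite)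

theorem weight_pow (hB : ∀ v, H (B v) = B (H v) - (2 : F) • B v) (v : V) (k : ℕ) :
    H ((B ^ k) v) = (B ^ k) (H v) - (2 * k : F) • (B ^ k) v := by
  induction k with
  | zero => simp
  | succ k ih =>
    simp only [pow_succ', Module.End.mul_apply, hB, ih, map_sub, map_smul, Nat.cast_succ]
    module

theorem raise_pow (hB : ∀ v, H (B v) = B (H v) - (2 : F) • B v)
    (hAB : ∀ v, A (B v) = H v - B (A v)) {v : V} (hv : A v = 0) (k : ℕ) :
    A ((B ^ (2 * k + 1)) v) = (B ^ (2 * k)) (H v - (2 * k : F) • v) ∧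
      A ((B ^ (2 * k + 2)) v) = -((2 * k + 2 : F) • (B ^ (2 * k + 1)) v) := by
  have step : ∀ n : ℕ, A ((B ^ (n + 1)) v) = H ((B ^ n) v) - B (A ((B ^ n) v)) := by
    intro n
    rw [pow_succ', Module.End.mul_apply, hAB]
  have apply_pow : ∀ (n : ℕ) (w : V), B ((B ^ n) w) = (B ^ (n + 1)) w := by
    intro n w
    rw [pow_succ', Module.End.mul_apply]
  have odd_to_even : ∀ k : ℕ, A ((B ^ (2 * k + 1)) v) = (B ^ (2 * k)) (H v - (2 * k : F) • v) →
      A ((B ^ (2 * k + 2)) v) = -((2 * k + 2 : F) • (B ^ (2 * k + 1)) v) := by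
    intro k hk
    rw [step, hk, weight_pow hB, apply_pow, map_sub, map_smul]
    push_cast
    module
  induction k with
  | zero =>
    have h0 : A ((B ^ (2 * 0 + 1)) v) = (B ^ (2 * 0)) (H v - (2 * (0 : ℕ) : F) • v) := by
      simp [hAB, hv]
    exact ⟨h0, odd_to_even 0 h0⟩
  | succ k ih =>
    have h1 : A ((B ^ (2 * (k + 1) + 1)) v)
        = (B ^ (2 * (k + 1))) (H v - (2 * (k + 1 : ℕ) : F) • v) := by
      rw [step, show 2 * (k + 1) = 2 * k + 2 by ring, ih.2, weight_pow hB, map_neg, map_smul,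
        apply_pow, map_sub, map_smul]
      push_cast
      module
    exact ⟨h1, odd_to_even _ h1⟩

/-- If `B` is locally nilpotent on a nonzero `H`-stable set of vectors killed by `A`, that set
contains a vector whose weight is twice a natural number `m`, and whose `B`-string has length
`2 * m + 1`. -/
theorem exists_highest_weight [CharZero F]
    (hA : ∀ v, H (A v) = A (H v) + (2 : F) • A v)
    (hB : ∀ v, H (B v) = B (H v) - (2 : F) • B v)
    (hAB : ∀ v, A (B v) = H v - B (A v)) {N : ℕ} (hN : B ^ N = 0)
    (U : Submodule F V) (hU : ∀ v ∈ U, H v ∈ U) (hne : ∃ v ∈ U, v ≠ 0 ∧ A v = 0) :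
    ∃ v ∈ U, ∃ m : ℕ, A v = 0 ∧ H v = (2 * m : F) • v ∧
      (∀ k ≤ 2 * m, (B ^ k) v ≠ 0) ∧ (B ^ (2 * m + 1)) v = 0 := by
  classical
  have hex : ∃ n : ℕ, ∃ v ∈ U, v ≠ 0 ∧ A v = 0 ∧ (B ^ n) v = 0 := by
    obtain ⟨v, hv, hv0, hAv⟩ := hne
    exact ⟨N, v, hv, hv0, hAv, by simp [hN]⟩
  obtain ⟨v, hvU, hv0, hAv, hBv⟩ := Nat.find_spec hex
  have hmin : ∀ k < Nat.find hex, ∀ w ∈ U, A w = 0 → (B ^ k) w = 0 → w = 0 := by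
    intro k hk w hw hAw hBw
    by_contra hw0
    exact Nat.find_min hex hk ⟨w, hw, hw0, hAw, hBw⟩
  generalize Nat.find hex = n at hBv hmin
  obtain ⟨m, rfl | rfl⟩ := Nat.even_or_odd' n
  · exfalso
    cases m with
    | zero => exact hv0 (by simpa using hBv)
    | succ k =>
      have h2 := (raise_pow hB hAB hAv k).2
      rw [show 2 * k + 2 = 2 * (k + 1) by ring, hBv, map_zero, eq_comm, neg_eq_zero,
        smul_eq_zero] at h2
      rcases h2 with h2 | h2
      · exact absurd h2 (by exact_mod_cast (by omega : 2 * k + 2 ≠ 0))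
      · exact hv0 (hmin _ (by omega) v hvU hAv h2)
  · refine ⟨v, hvU, m, hAv, ?_, fun k hk h0 => hv0 (hmin k (by omega) v hvU hAv h0), hBv⟩
    have h1 := (raise_pow hB hAB hAv m).1
    rw [hBv, map_zero] at h1
    have hAH : A (H v) = 0 := by
      have := hA v
      simpa [hAv] using this.symm
    refine sub_eq_zero.mp (hmin _ (by omega) _ (U.sub_mem (hU v hvU) (U.smul_mem _ hvU)) ?_ h1.symm)
    simp [hAH, hAv]

/-- In a basis of eigenvectors with distinct eigenvalues, every eigenvector is a multiple of a
basis vector. -/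
theorem eq_smul_basis_of_eigenvector {ι : Type} (b : Module.Basis ι F V) {μ : ι → F}
    (hμ : Function.Injective μ) (hb : ∀ i, H (b i) = μ i • b i) {w : V} (hw : w ≠ 0) {c : F}
    (hc : H w = c • w) : ∃ i, c = μ i ∧ ∃ a : F, a ≠ 0 ∧ w = a • b i := by
  have key : ∀ i, b.coord i ∘ₗ H = μ i • b.coord i := by
    intro i
    refine b.ext fun j => ?_
    by_cases hij : j = i
    · subst hij
      simp [hb]
    · simp [hb, hij]
  have hcoord : ∀ i, b.coord i w ≠ 0 → c = μ i := by
    intro i hi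
    have h1 := LinearMap.congr_fun (key i) w
    simp only [LinearMap.comp_apply, hc, map_smul, LinearMap.smul_apply, smul_eq_mul] at h1
    exact mul_right_cancel₀ hi h1
  obtain ⟨i, hi⟩ : ∃ i, b.coord i w ≠ 0 := by
    by_contra! h0
    exact hw (b.forall_coord_eq_zero_iff.mp h0)
  refine ⟨i, hcoord i hi, b.coord i w, hi, b.ext_elem fun j => ?_⟩
  by_cases hij : i = j
  · subst hij
    simp
  · have : b.coord j w = 0 := by
      by_contra hj
      exact hij (hμ ((hcoord i hi).symm.trans (hcoord j hj)))
    simpa [Finsupp.single_apply, hij] using this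

/-- A nonzero subspace stable under a diagonalizable operator contains an eigenvector. -/
theorem exists_eigenvector_mem_of_invariant [FiniteDimensional F V] {ι : Type} (b : Module.Basis ι F V) {μ : ι → F}
    (hb : ∀ i, H (b i) = μ i • b i) {W : Submodule F V} (hW : ∀ v ∈ W, H v ∈ W) (hne : W ≠ ⊥) :
    ∃ w ∈ W, w ≠ 0 ∧ ∃ c : F, H w = c • w := by
  have htop : ⨆ c, H.eigenspace c = ⊤ := by
    rw [eq_top_iff, ← b.span_eq, Submodule.span_le]
    rintro _ ⟨i, rfl⟩
    exact Submodule.mem_iSup_of_mem (μ i) (Module.End.mem_eigenspace_iff.mpr (hb i))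
  have hsup := Submodule.eq_iSup_inf_genEigenspace 1 hW htop
  obtain ⟨c, hc⟩ : ∃ c, W ⊓ H.genEigenspace c 1 ≠ ⊥ := by
    by_contra! h0
    exact hne (by rw [hsup, iSup_eq_bot]; exact h0)
  obtain ⟨w, hw, hw0⟩ := Submodule.exists_mem_ne_zero_of_ne_bot hc
  exact ⟨w, hw.1, hw0, c, Module.End.mem_eigenspace_iff.mp hw.2⟩

end Operators

section OspModules

variable {g : LieSuperAlgebra F L} {e f h : L}

/-- A subspace stable under an `osp`-triple is stable under the whole Lie superalgebra. -/
theorem LieSuperModule.act_mem_of_isOspTriple (M : LieSuperModule g V) (ht : g.IsOspTriple e f h)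
    {W : Submodule F V} (he : ∀ v ∈ W, M.act e v ∈ W) (hf : ∀ v ∈ W, M.act f v ∈ W)
    (hh : ∀ v ∈ W, M.act h v ∈ W) (x : L) : ∀ v ∈ W, M.act x v ∈ W := by
  let T : Submodule F L :=
    { carrier := {x | ∀ v ∈ W, M.act x v ∈ W}
      add_mem' := fun hx hy v hv => by
        simpa using W.add_mem (hx v hv) (hy v hv)
      zero_mem' := fun v _ => by simp
      smul_mem' := fun c x hx v hv => by
        simpa using W.smul_mem c (hx v hv) }
  have hbr : ∀ i j : ZMod 2, ∀ x ∈ T ⊓ g.carrier i, ∀ y ∈ T ⊓ g.carrier j,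
      g.bracket x y ∈ T ⊓ g.carrier (i + j) := by
    rintro i j x ⟨hx, hxi⟩ y ⟨hy, hyj⟩
    refine ⟨fun v hv => ?_, g.bracket_mem i j x hxi y hyj⟩
    rw [M.bracket_act i j x hxi y hyj]
    exact W.sub_mem (hx _ (hy v hv)) (W.smul_mem _ (hy _ (hx v hv)))
  let S : Submodule F L := ⨆ i : ZMod 2, T ⊓ g.carrier i
  have hle : ∀ i, T ⊓ g.carrier i ≤ S := le_iSup (fun i : ZMod 2 => T ⊓ g.carrier i)
  have htop : S = ⊤ := by
    refine ht.gen S (hle 1 ⟨he, ht.e_mem⟩) (hle 1 ⟨hf, ht.f_mem⟩) (hle 0 ⟨hh, ht.h_mem⟩) ?_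
    intro x hx y hy
    induction hx using Submodule.iSup_induction' with
    | zero => simp
    | add x x' _ _ hx hx' => simpa using S.add_mem hx hx'
    | mem i x hx =>
      induction hy using Submodule.iSup_induction' with
      | zero => simp
      | add y y' _ _ hy hy' => simpa using S.add_mem hy hy'
      | mem j y hy => exact hle _ (hbr i j x hx y hy)
  have hST : S ≤ T := iSup_le fun i => inf_le_left
  exact hST (htop ▸ Submodule.mem_top : x ∈ S)

theorem LieSuperModule.act_h_act_e_s4 (M : LieSuperModule g V) (ht : g.IsOspTriple e f h) (v : V) :
    M.act h (M.act e v) = M.act e (M.act h v) + (2 : F) • M.act e v := by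
  have h1 := M.bracket_act 0 1 h ht.h_mem e ht.e_mem v
  simp only [ht.he, map_smul, LinearMap.smul_apply, ZMod.val_zero, zero_mul, pow_zero,
    one_smul] at h1
  rw [h1]
  abel

theorem LieSuperModule.act_h_act_f_s4 (M : LieSuperModule g V) (ht : g.IsOspTriple e f h) (v : V) :
    M.act h (M.act f v) = M.act f (M.act h v) - (2 : F) • M.act f v := by
  have h1 := M.bracket_act 0 1 h ht.h_mem f ht.f_mem v
  simp only [ht.hf, map_neg, LinearMap.neg_apply, map_smul, LinearMap.smul_apply, ZMod.val_zero,
    zero_mul, pow_zero, one_smul] at h1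
  rw [sub_eq_add_neg, h1]
  abel

theorem LieSuperModule.act_bracket_odd (M : LieSuperModule g V) {x y : L} (hx : x ∈ g.carrier 1)
    (hy : y ∈ g.carrier 1) (v : V) :
    M.act (g.bracket x y) v = M.act x (M.act y v) + M.act y (M.act x v) := by
  rw [M.bracket_act 1 1 x hx y hy v, ZMod.val_one]
  simp

theorem LieSuperModule.act_e_act_f_s4 (M : LieSuperModule g V) (ht : g.IsOspTriple e f h) (v : V) :
    M.act e (M.act f v) = M.act h v - M.act f (M.act e v) := by
  rw [eq_sub_iff_add_eq, ← M.act_bracket_odd ht.e_mem ht.f_mem, ht.ef]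

theorem LieSuperModule.pow_act_mem (M : LieSuperModule g V) {x : L} (hx : x ∈ g.carrier 1)
    {i : ZMod 2} {v : V} (hv : v ∈ M.carrier i) (k : ℕ) :
    (M.act x ^ k) v ∈ M.carrier (i + k) := by
  induction k with
  | zero => simpa using hv
  | succ k ih =>
    rw [pow_succ', Module.End.mul_apply, Nat.cast_succ,
      show i + ((k : ZMod 2) + 1) = 1 + (i + k) by ring]
    exact M.act_mem 1 _ x hx _ ih

theorem LieSuperModule.disjoint_carrier (M : LieSuperModule g V) {i j : ZMod 2} (hij : i ≠ j) :
    Disjoint (M.carrier i) (M.carrier j) := by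
  have h01 := M.isCompl.disjoint
  revert hij
  fin_cases i <;> fin_cases j
  · exact fun h => absurd rfl h
  · exact fun _ => h01
  · exact fun _ => h01.symm
  · exact fun h => absurd rfl h

theorem LieSuperModule.exists_homogeneous_ne_zero (M : LieSuperModule g V) (hV : ∃ v : V, v ≠ 0) :
    ∃ i, ∃ v ∈ M.carrier i, v ≠ 0 := by
  by_contra! h0
  obtain ⟨v, hv⟩ := hV
  have hvtop : v ∈ M.carrier 0 ⊔ M.carrier 1 := M.isCompl.sup_eq_top ▸ Submodule.mem_top
  obtain ⟨a, ha, b, hb, rfl⟩ := Submodule.mem_sup.mp hvtop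
  exact hv (by rw [h0 0 a ha, h0 1 b hb, add_zero])

/-- A subspace spanned by homogeneous vectors is graded. -/
theorem LieSuperModule.span_le_of_homogeneous (M : LieSuperModule g V) {s : Set V}
    (hs : ∀ v ∈ s, ∃ i, v ∈ M.carrier i) :
    Submodule.span F s ≤
      (Submodule.span F s ⊓ M.carrier 0) ⊔ (Submodule.span F s ⊓ M.carrier 1) := by
  rw [Submodule.span_le]
  intro v hv
  obtain ⟨i, hi⟩ := hs v hv
  have hvs := Submodule.subset_span (R := F) hv
  fin_cases i
  · exact Submodule.mem_sup_left ⟨hvs, hi⟩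
  · exact Submodule.mem_sup_right ⟨hvs, hi⟩

/-- A finite-dimensional irreducible module has a homogeneous basis consisting of the vectors
`f ^ k · v` for a highest weight vector `v` of weight `2 * m`. -/
theorem LieSuperModule.IsIrreducible.exists_basis [CharZero F] [FiniteDimensional F V]
    {M : LieSuperModule g V} (hirr : M.IsIrreducible) (ht : g.IsOspTriple e f h) :
    ∃ (i : ZMod 2) (v : V) (m : ℕ) (b : Module.Basis (Fin (2 * m + 1)) F V),
      v ∈ M.carrier i ∧ M.act e v = 0 ∧ M.act h v = (2 * m : F) • v ∧
      ∀ k, b k = (M.act f ^ (k : ℕ)) v := by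
  have hA := M.act_h_act_e_s4 ht
  have hB := M.act_h_act_f_s4 ht
  have hAB := M.act_e_act_f_s4 ht
  obtain ⟨n, hn⟩ := exists_pow_eq_zero_of_commutator hA
  obtain ⟨N, hN⟩ : ∃ N : ℕ, M.act f ^ N = 0 := by
    refine exists_pow_eq_zero_of_commutator (H := -M.act h) fun v => ?_
    rw [LinearMap.neg_apply, LinearMap.neg_apply, hB, map_neg]
    abel
  obtain ⟨j, w, hwj, hw0⟩ := M.exists_homogeneous_ne_zero hirr.1
  classical
  have hex : ∃ n, (M.act e ^ n) w = 0 := ⟨n, by simp [hn]⟩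
  obtain ⟨p, hp⟩ : ∃ p, Nat.find hex = p + 1 := Nat.exists_eq_succ_of_ne_zero fun h0 =>
    hw0 (by simpa [h0] using Nat.find_spec hex)
  have hlast : M.act e ((M.act e ^ p) w) = 0 := by
    rw [← Module.End.mul_apply, ← pow_succ', ← hp]
    exact Nat.find_spec hex
  obtain ⟨v, hv, m, hev, hhv, hne, hzero⟩ := exists_highest_weight hA hB hAB hN
    (M.carrier (j + p))
    (fun v hv => by simpa using M.act_mem 0 _ h ht.h_mem v hv)
    ⟨_, M.pow_act_mem ht.e_mem hwj p, Nat.find_min hex (by omega), hlast⟩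
  have hweight : ∀ k : ℕ, M.act h ((M.act f ^ k) v) = (2 * m - 2 * k : F) • (M.act f ^ k) v := by
    intro k
    rw [weight_pow hB, hhv, map_smul, sub_smul]
  have happly : ∀ k : ℕ, M.act f ((M.act f ^ k) v) = (M.act f ^ (k + 1)) v := by
    intro k
    rw [pow_succ', Module.End.mul_apply]
  have hli : LinearIndependent F (fun k : Fin (2 * m + 1) => (M.act f ^ (k : ℕ)) v) := by
    refine Module.End.eigenvectors_linearIndependent' (M.act h)
      (fun k : Fin (2 * m + 1) => (2 * m - 2 * (k : ℕ) : F)) ?_ _ fun k =>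
        ⟨Module.End.mem_eigenspace_iff.mpr (hweight k), hne k (by omega)⟩
    intro k l hkl
    simpa [Fin.ext_iff] using hkl
  set W := Submodule.span F (Set.range fun k : Fin (2 * m + 1) => (M.act f ^ (k : ℕ)) v) with hW
  have hmem : ∀ k : ℕ, (M.act f ^ k) v ∈ W := by
    intro k
    by_cases hk : k < 2 * m + 1
    · exact Submodule.subset_span ⟨⟨k, hk⟩, rfl⟩
    · obtain ⟨d, rfl⟩ := Nat.exists_eq_add_of_le (not_lt.mp hk)
      rw [add_comm, pow_add, Module.End.mul_apply, hzero, map_zero]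
      exact W.zero_mem
  have stable : ∀ x : L, (∀ k : ℕ, M.act x ((M.act f ^ k) v) ∈ W) → ∀ u ∈ W, M.act x u ∈ W := by
    intro x hx u hu
    have : W ≤ W.comap (M.act x) := by
      rw [hW, Submodule.span_le]
      rintro _ ⟨k, rfl⟩
      exact hx k
    exact this hu
  have hsub : M.IsSub W := by
    refine ⟨M.span_le_of_homogeneous ?_, M.act_mem_of_isOspTriple ht (stable e ?_) (stable f ?_)
      (stable h ?_)⟩
    · rintro _ ⟨k, rfl⟩
      exact ⟨_, M.pow_act_mem ht.f_mem hv k⟩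
    · intro k
      cases k with
      | zero => simp [hev]
      | succ k =>
        obtain ⟨q, rfl | rfl⟩ := Nat.even_or_odd' k
        · rw [(raise_pow hB hAB hev q).1, hhv, ← sub_smul, map_smul]
          exact W.smul_mem _ (hmem _)
        · rw [(raise_pow hB hAB hev q).2]
          exact W.neg_mem (W.smul_mem _ (hmem _))
    · exact fun k => happly k ▸ hmem (k + 1)
    · exact fun k => hweight k ▸ W.smul_mem _ (hmem k)
  have htop : W = ⊤ := by
    refine (hirr.2 W hsub).resolve_left fun hbot => ?_
    have h0 := hmem 0
    rw [hbot, Submodule.mem_bot] at h0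
    exact hne 0 (Nat.zero_le _) h0
  refine ⟨j + p, v, m, Module.Basis.mk hli htop.ge, hv, hev, hhv, fun k => ?_⟩
  rw [Module.Basis.mk_apply]

theorem LieSuperModule.carrier_le_of_span (M : LieSuperModule g V) {i : ZMod 2}
    {W : Submodule F V} (hW : W ≤ M.carrier i) (htop : W ⊔ M.carrier (i + 1) = ⊤) :
    M.carrier i ≤ W := by
  intro x hx
  have hxtop : x ∈ W ⊔ M.carrier (i + 1) := htop ▸ Submodule.mem_top
  obtain ⟨w, hw, y, hy, rfl⟩ := Submodule.mem_sup.mp hxtop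
  have hyi : y ∈ M.carrier i := by
    simpa using (M.carrier i).sub_mem hx (hW hw)
  have hy0 : y = 0 := Submodule.disjoint_def.mp
    (M.disjoint_carrier (show i ≠ i + 1 by simp)) y hyi hy
  simpa [hy0] using hw

/-- The homogeneous parts have no proper nonzero subspaces stable under `[e,e]`, `[f,f]`, `h`. -/
theorem LieSuperModule.eq_carrier_of_even_stable [CharZero F] [FiniteDimensional F V]
    (M : LieSuperModule g V) (ht : g.IsOspTriple e f h) {i : ZMod 2} {v : V} {m : ℕ}
    (b : Module.Basis (Fin (2 * m + 1)) F V) (hv : v ∈ M.carrier i) (hev : M.act e v = 0)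
    (hhv : M.act h v = (2 * m : F) • v) (hb : ∀ k, b k = (M.act f ^ (k : ℕ)) v)
    {j : ZMod 2} {W : Submodule F V} (hWj : W ≤ M.carrier j)
    (hW : ∀ v ∈ W, M.act (g.bracket e e) v ∈ W ∧ M.act (g.bracket f f) v ∈ W ∧ M.act h v ∈ W)
    (hne : W ≠ ⊥) : W = M.carrier j := by
  have hB := M.act_h_act_f_s4 ht
  have hAB := M.act_e_act_f_s4 ht
  have hbh : ∀ k, M.act h (b k) = (2 * m - 2 * (k : ℕ) : F) • b k := by
    intro k
    rw [hb, weight_pow hB, hhv, map_smul, sub_smul]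
  have hinj : Function.Injective fun k : Fin (2 * m + 1) => (2 * m - 2 * (k : ℕ) : F) := by
    intro k l hkl
    simpa [Fin.ext_iff] using hkl
  have double : ∀ x ∈ g.carrier 1, (∀ u ∈ W, M.act (g.bracket x x) u ∈ W) →
      ∀ u ∈ W, M.act x (M.act x u) ∈ W := by
    intro x hx hxW u hu
    have h1 := hxW u hu
    rw [M.act_bracket_odd hx hx, ← two_smul F] at h1
    exact (W.smul_mem_iff two_ne_zero).mp h1
  have up : ∀ k, (M.act f ^ k) v ∈ W → ∀ d, (M.act f ^ (k + 2 * d)) v ∈ W := by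
    intro k hk d
    induction d with
    | zero => simpa using hk
    | succ d ih =>
      have h1 := double f ht.f_mem (fun u hu => (hW u hu).2.1) _ ih
      rwa [show k + 2 * (d + 1) = k + 2 * d + 1 + 1 by ring, pow_succ', pow_succ',
        Module.End.mul_apply, Module.End.mul_apply]
  have raise : ∀ k < 2 * m, ∃ a : F, a ≠ 0 ∧
      M.act e ((M.act f ^ (k + 1)) v) = a • (M.act f ^ k) v := by
    intro k hk
    obtain ⟨q, rfl | rfl⟩ := Nat.even_or_odd' k
    · refine ⟨2 * m - 2 * q, ?_, ?_⟩
      · rw [sub_ne_zero]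
        exact_mod_cast (by omega : 2 * m ≠ 2 * q)
      · rw [(raise_pow hB hAB hev q).1, hhv, ← sub_smul, map_smul]
    · refine ⟨-(2 * q + 2), ?_, ?_⟩
      · rw [neg_ne_zero]
        exact_mod_cast (by omega : 2 * q + 2 ≠ 0)
      · rw [(raise_pow hB hAB hev q).2, neg_smul]
  have down : ∀ d k, k + 2 * d ≤ 2 * m → (M.act f ^ (k + 2 * d)) v ∈ W →
      (M.act f ^ k) v ∈ W := by
    intro d
    induction d with
    | zero => exact fun k _ hk => by simpa using hk
    | succ d ih =>
      intro k hk hmem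
      refine ih k (by omega) ?_
      have h1 := double e ht.e_mem (fun u hu => (hW u hu).1) _ hmem
      obtain ⟨a, ha, hae⟩ := raise (k + 2 * d + 1) (by omega)
      obtain ⟨a', ha', hae'⟩ := raise (k + 2 * d) (by omega)
      rw [show k + 2 * (d + 1) = k + 2 * d + 1 + 1 by ring, hae, map_smul, hae', smul_smul] at h1
      exact (W.smul_mem_iff (mul_ne_zero ha ha')).mp h1
  obtain ⟨w, hw, hw0, c, hc⟩ :=
    exists_eigenvector_mem_of_invariant b hbh (fun u hu => (hW u hu).2.2) hne
  obtain ⟨k, -, a, ha, rfl⟩ := eq_smul_basis_of_eigenvector b hinj hbh hw0 hc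
  have hkW : b k ∈ W := (W.smul_mem_iff ha).mp hw
  have hbmem : ∀ l : Fin (2 * m + 1), b l ∈ M.carrier (i + (l : ℕ)) :=
    fun l => hb l ▸ M.pow_act_mem ht.f_mem hv l
  have hj : i + (k : ℕ) = j := by
    by_contra hij
    exact b.ne_zero k (Submodule.disjoint_def.mp (M.disjoint_carrier hij) _ (hbmem k) (hWj hkW))
  refine le_antisymm hWj (M.carrier_le_of_span hWj ?_)
  rw [eq_top_iff, ← b.span_eq, Submodule.span_le]
  rintro _ ⟨l, rfl⟩
  by_cases hkl : ((k : ℕ) : ZMod 2) = (l : ℕ)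
  · refine Submodule.mem_sup_left ?_
    rw [hb] at hkW ⊢
    have hmod : (k : ℕ) % 2 = (l : ℕ) % 2 := (ZMod.natCast_eq_natCast_iff _ _ _).mp hkl
    rcases le_total (k : ℕ) l with hle | hle
    · obtain ⟨d, hd⟩ : ∃ d, (l : ℕ) = k + 2 * d := ⟨(l - k) / 2, by omega⟩
      exact hd ▸ up k hkW d
    · obtain ⟨d, hd⟩ : ∃ d, (k : ℕ) = l + 2 * d := ⟨(k - l) / 2, by omega⟩
      exact down d l (by omega) (hd ▸ hkW)
  · refine Submodule.mem_sup_right ?_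
    have hl : ((l : ℕ) : ZMod 2) = (k : ℕ) + 1 := by
      generalize ((k : ℕ) : ZMod 2) = x at hkl
      generalize ((l : ℕ) : ZMod 2) = y at hkl
      revert x y
      decide
    have h1 := hbmem l
    rwa [hl, ← add_assoc, hj] at h1

end OspModules


/-- structure of finite-dimensional irreducible `osp(1,2)`-modules:
one-dimensional eigenspaces of `π(h)`, eigenvalues `{-λ, -λ+2, …, λ}` for a nonnegative
even integer `λ`, and for `λ ≠ 0` irreducibility of `V₀`, `V₁` as `g₀`-modules together
with the description of the eigenvalues of `(1/2)π(h)` on each part. -/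
theorem osp_irreducible_structure
    {F : Type} [Field F] [CharZero F] {L : Type} [AddCommGroup L] [Module F L]
    (g : LieSuperAlgebra F L) (e f h : L) (ht : g.IsOspTriple e f h)
    {V : Type} [AddCommGroup V] [Module F V] [FiniteDimensional F V]
    (M : LieSuperModule g V) (hirr : M.IsIrreducible) :
    (∀ μ : F, Module.End.HasEigenvalue (M.act h) μ →
        Module.finrank F (Module.End.eigenspace (M.act h) μ) = 1) ∧
    ∃ lam : ℕ, Even lam ∧
      ({μ : F | Module.End.HasEigenvalue (M.act h) μ}
          = {μ : F | ∃ k : ℕ, k ≤ lam ∧ μ = (lam : F) - 2 * k}) ∧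
      (lam ≠ 0 →
        (∀ i : ZMod 2,
          M.carrier i ≠ ⊥ ∧
          ∀ W : Submodule F V, W ≤ M.carrier i →
            (∀ v ∈ W, M.act (g.bracket e e) v ∈ W ∧ M.act (g.bracket f f) v ∈ W ∧
                M.act h v ∈ W) →
            W = ⊥ ∨ W = M.carrier i) ∧
        ∃ i : ZMod 2,
          ({μ : F | ∃ v ∈ M.carrier i, v ≠ 0 ∧ M.act h v = (2 * μ) • v}
              = {μ : F | ∃ k : ℕ, 2 * k ≤ lam ∧ μ = -((lam : F) / 2) + 2 * k}) ∧
          ({μ : F | ∃ v ∈ M.carrier (i + 1), v ≠ 0 ∧ M.act h v = (2 * μ) • v}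
              = {μ : F | ∃ k : ℕ, 2 * k + 2 ≤ lam ∧
                  μ = -((lam : F) / 2) + 1 + 2 * k})) := by
  obtain ⟨i, v, m, b, hv, hev, hhv, hb⟩ := hirr.exists_basis ht
  have hbh : ∀ k, M.act h (b k) = (2 * m - 2 * (k : ℕ) : F) • b k := by
    intro k
    rw [hb, weight_pow (M.act_h_act_f_s4 ht), hhv, map_smul, sub_smul]
  have hinj : Function.Injective fun k : Fin (2 * m + 1) => (2 * m - 2 * (k : ℕ) : F) := by
    intro k l hkl
    simpa [Fin.ext_iff] using hkl
  have hbmem : ∀ l : Fin (2 * m + 1), b l ∈ M.carrier (i + (l : ℕ)) :=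
    fun l => hb l ▸ M.pow_act_mem ht.f_mem hv l
  have hpart : ∀ (j : ZMod 2) (μ : F),
      (∃ w ∈ M.carrier j, w ≠ 0 ∧ M.act h w = (2 * μ) • w) ↔
        ∃ k : ℕ, k ≤ 2 * m ∧ j = i + k ∧ μ = m - k := by
    intro j μ
    constructor
    · rintro ⟨w, hwj, hw0, hw⟩
      obtain ⟨k, hμ, a, ha, rfl⟩ := eq_smul_basis_of_eigenvector b hinj hbh hw0 hw
      refine ⟨k, by omega, ?_, ?_⟩
      · by_contra hij
        exact b.ne_zero k (Submodule.disjoint_def.mp (M.disjoint_carrier hij) _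
          (((M.carrier j).smul_mem_iff ha).mp hwj) (hbmem k))
      · exact mul_left_cancel₀ two_ne_zero (hμ.trans (mul_sub _ _ _).symm)
    · rintro ⟨k, hk, rfl, rfl⟩
      refine ⟨b ⟨k, by omega⟩, hbmem ⟨k, by omega⟩, b.ne_zero _, ?_⟩
      rw [hbh, mul_sub]
  refine ⟨fun μ hμ => ?_, 2 * m, even_two_mul m, ?_, fun hm => ⟨fun j => ⟨?_, fun W hWj hW => ?_⟩,
    i, ?_, ?_⟩⟩
  · obtain ⟨w, hw, hw0⟩ := hμ.exists_hasEigenvector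
    obtain ⟨k, rfl, -⟩ := eq_smul_basis_of_eigenvector b hinj hbh hw0
      (Module.End.mem_eigenspace_iff.mp hw)
    have hspan : Module.End.eigenspace (M.act h) (2 * m - 2 * (k : ℕ) : F)
        = Submodule.span F {b k} := by
      refine le_antisymm (fun u hu => ?_) ?_
      · by_cases hu0 : u = 0
        · exact hu0 ▸ Submodule.zero_mem _
        · obtain ⟨l, hl, a, -, rfl⟩ := eq_smul_basis_of_eigenvector b hinj hbh hu0
            (Module.End.mem_eigenspace_iff.mp hu)
          rw [hinj hl]
          exact Submodule.smul_mem _ _ (Submodule.mem_span_singleton_self _)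
      · rw [Submodule.span_singleton_le_iff_mem, Module.End.mem_eigenspace_iff]
        exact hbh k
    rw [hspan, finrank_span_singleton (b.ne_zero k)]
  · ext μ
    simp only [Set.mem_ofPred_eq, Nat.cast_mul, Nat.cast_ofNat]
    constructor
    · intro hμ
      obtain ⟨w, hw, hw0⟩ := hμ.exists_hasEigenvector
      obtain ⟨k, rfl, -⟩ := eq_smul_basis_of_eigenvector b hinj hbh hw0
        (Module.End.mem_eigenspace_iff.mp hw)
      exact ⟨k, by omega, rfl⟩
    · rintro ⟨k, hk, rfl⟩
      exact Module.End.hasEigenvalue_of_hasEigenvector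
        ⟨Module.End.mem_eigenspace_iff.mpr (hbh ⟨k, by omega⟩), b.ne_zero _⟩
  · rw [Submodule.ne_bot_iff]
    have parity : ∀ i j : ZMod 2, j = i ∨ j = i + 1 := by decide
    obtain rfl | rfl := parity i j
    · exact ⟨_, by simpa using hbmem ⟨0, by omega⟩, b.ne_zero _⟩
    · exact ⟨_, by simpa using hbmem ⟨1, by omega⟩, b.ne_zero _⟩
  · exact or_iff_not_imp_left.mpr
      (M.eq_carrier_of_even_stable ht b hv hev hhv hb hWj hW)
  · ext μ
    rw [Set.mem_ofPred_eq, hpart, Set.mem_ofPred_eq]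
    constructor
    · rintro ⟨k, hk, hik, rfl⟩
      have hk2 : 2 ∣ k := (ZMod.natCast_eq_zero_iff k 2).mp (by simpa using hik)
      obtain ⟨q, rfl⟩ := hk2
      obtain ⟨r, rfl⟩ := Nat.exists_eq_add_of_le (show q ≤ m by omega)
      refine ⟨r, by omega, ?_⟩
      push_cast
      ring
    · rintro ⟨r, hr, rfl⟩
      obtain ⟨q, rfl⟩ := Nat.exists_eq_add_of_le (show r ≤ m by omega)
      refine ⟨2 * q, by omega, ?_, ?_⟩
      · simp [(ZMod.natCast_eq_zero_iff (2 * q) 2).mpr (dvd_mul_right 2 q)]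
      · push_cast
        ring
  · ext μ
    rw [Set.mem_ofPred_eq, hpart, Set.mem_ofPred_eq]
    constructor
    · rintro ⟨k, hk, hik, rfl⟩
      have hk1 : (k : ZMod 2) = (1 : ℕ) := by simpa using (add_left_cancel hik).symm
      have hmod : k % 2 = 1 % 2 := (ZMod.natCast_eq_natCast_iff _ _ _).mp hk1
      obtain ⟨q, rfl⟩ : ∃ q, k = 2 * q + 1 := ⟨k / 2, by omega⟩
      obtain ⟨r, rfl⟩ := Nat.exists_eq_add_of_le (show q + 1 ≤ m by omega)
      refine ⟨r, by omega, ?_⟩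
      push_cast
      ring
    · rintro ⟨r, hr, rfl⟩
      obtain ⟨q, rfl⟩ := Nat.exists_eq_add_of_le (show r + 1 ≤ m by omega)
      refine ⟨2 * q + 1, by omega, ?_, ?_⟩
      · rw [Nat.cast_succ, (ZMod.natCast_eq_zero_iff (2 * q) 2).mpr (dvd_mul_right 2 q), zero_add]
      · push_cast
        ring
end

section
/- Let g be a Lie superalgebra over a field F of characteristic zero admitting an osp-triple (e,f,h). Then: (a) every nonzero finite-dimensional irreducible g-module has odd dimension; (b) for each nonnegative even integer λ, the superspace V with homogeneous basis {v₀, …, v_λ} in which {v_{2i} : 0 ≤ i ≤ λ/2} is a basis of one of V₀ or V₁ and the remaining v_j span the other part, equipped with the action determined by f·v_i := v_{i+1}, h·v_i := (λ-2i)v_i, e·v_i := -i v_{i-1} for even i and e·v_i := (λ-(i-1)) v_{i-1} for odd i (with v_{-1} = v_{λ+1} := 0), is an irreducible g-module of dimension λ+1, and any finite-dimensional irreducible g-module of dimension λ+1 is isomorphic to it. -/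
variable {F : Type} [Field F] {L : Type} [AddCommGroup L] [Module F L]

variable {V : Type} [AddCommGroup V] [Module F V]

theorem ZMod.eq_zero_or_eq_one_of_two (i : ZMod 2) : i = 0 ∨ i = 1 := by
  revert i
  decide

namespace LieSuperAlgebra

variable (g : LieSuperAlgebra F L) {x y : L}

theorem bracket_comm_odd (hx : x ∈ g.carrier 1) (hy : y ∈ g.carrier 1) :
    g.bracket x y = g.bracket y x := by
  simpa [ZMod.val_one] using g.skew 1 1 x hx y hy

theorem bracket_comm_even {j : ZMod 2} (hx : x ∈ g.carrier j) (hy : y ∈ g.carrier 0) :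
    g.bracket x y = -g.bracket y x := by
  simpa using g.skew j 0 x hx y hy

theorem bracket_bracket_odd (hx : x ∈ g.carrier 1) (hy : y ∈ g.carrier 1) (z : L) :
    g.bracket (g.bracket x y) z = g.bracket x (g.bracket y z) + g.bracket y (g.bracket x z) := by
  simpa [ZMod.val_one] using g.super_jacobi 1 1 x hx y hy z

theorem bracket_odd_mem_even (hx : x ∈ g.carrier 1) (hy : y ∈ g.carrier 1) :
    g.bracket x y ∈ g.carrier 0 := g.bracket_mem 1 1 x hx y hy

theorem bracket_self_bracket_self [CharZero F] (hx : x ∈ g.carrier 1) :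
    g.bracket x (g.bracket x x) = 0 := by
  have h₁ := g.bracket_bracket_odd hx hx x
  have h₂ := g.bracket_comm_even hx (g.bracket_odd_mem_even hx hx)
  rw [h₁] at h₂
  have h₃ : (3 : F) • g.bracket x (g.bracket x x) = 0 := by
    linear_combination (norm := module) h₂
  exact (smul_eq_zero.mp h₃).resolve_left (by norm_num)

namespace IsOspTriple

variable {g} {e f h : L}

theorem fe (ht : g.IsOspTriple e f h) : g.bracket f e = h := by
  rw [g.bracket_comm_odd ht.f_mem ht.e_mem, ht.ef]

theorem eh (ht : g.IsOspTriple e f h) : g.bracket e h = -((2 : F) • e) := by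
  rw [g.bracket_comm_even ht.e_mem ht.h_mem, ht.he]

theorem fh (ht : g.IsOspTriple e f h) : g.bracket f h = (2 : F) • f := by
  rw [g.bracket_comm_even ht.f_mem ht.h_mem, ht.hf, neg_neg]

theorem f_ee (ht : g.IsOspTriple e f h) : g.bracket f (g.bracket e e) = (4 : F) • e := by
  have h₁ := g.bracket_bracket_odd ht.f_mem ht.e_mem e
  rw [ht.fe, ht.he, ht.eh] at h₁
  linear_combination (norm := module) -h₁

theorem e_ff (ht : g.IsOspTriple e f h) : g.bracket e (g.bracket f f) = -((4 : F) • f) := by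
  have h₁ := g.bracket_bracket_odd ht.e_mem ht.f_mem f
  rw [ht.ef, ht.hf, ht.fh] at h₁
  linear_combination (norm := module) -h₁

theorem hh (ht : g.IsOspTriple e f h) : g.bracket h h = 0 := by
  have h₁ := g.bracket_bracket_odd ht.e_mem ht.f_mem h
  simpa [ht.ef, ht.fh, ht.eh, ht.fe] using h₁

theorem span_even_le (ht : g.IsOspTriple e f h) :
    Submodule.span F {h, g.bracket e e, g.bracket f f} ≤ g.carrier 0 := by
  simp [Submodule.span_le, Set.insert_subset_iff, ht.h_mem, g.bracket_odd_mem_even, ht.e_mem,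
    ht.f_mem]

theorem span_odd_le (ht : g.IsOspTriple e f h) :
    Submodule.span F {e, f} ≤ g.carrier 1 := by
  simp [Submodule.span_le, Set.insert_subset_iff, ht.e_mem, ht.f_mem]

variable [CharZero F]

theorem h_ee (ht : g.IsOspTriple e f h) :
    g.bracket h (g.bracket e e) = (4 : F) • g.bracket e e := by
  have h₁ := g.bracket_bracket_odd ht.e_mem ht.f_mem (g.bracket e e)
  simpa [ht.ef, ht.f_ee, g.bracket_self_bracket_self ht.e_mem] using h₁

theorem h_ff (ht : g.IsOspTriple e f h) :
    g.bracket h (g.bracket f f) = -((4 : F) • g.bracket f f) := by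
  have h₁ := g.bracket_bracket_odd ht.e_mem ht.f_mem (g.bracket f f)
  simpa [ht.ef, ht.e_ff, g.bracket_self_bracket_self ht.f_mem] using h₁

theorem ee_ne (ht : g.IsOspTriple e f h) : g.bracket e e ≠ 0 := fun h₀ => ht.e_ne <| by
  simpa [h₀] using ht.f_ee.symm

theorem ff_ne (ht : g.IsOspTriple e f h) : g.bracket f f ≠ 0 := fun h₀ => ht.f_ne <| by
  simpa [h₀] using ht.e_ff.symm

theorem linearIndependent (ht : g.IsOspTriple e f h) :
    LinearIndependent F ![g.bracket e e, e, h, f, g.bracket f f] := by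
  refine Module.End.eigenvectors_linearIndependent' (g.bracket h) ![4, 2, 0, -2, -4] ?_ _ ?_
  · intro i j hij
    fin_cases i <;> fin_cases j <;> first | rfl | (exfalso; norm_num at hij)
  · intro i
    rw [Module.End.hasEigenvector_iff, Module.End.mem_eigenspace_iff]
    fin_cases i
    · exact ⟨ht.h_ee, ht.ee_ne⟩
    · exact ⟨ht.he, ht.e_ne⟩
    · exact ⟨by simp [ht.hh], ht.h_ne⟩
    · exact ⟨by simp [ht.hf], ht.f_ne⟩
    · exact ⟨by simp [ht.h_ff], ht.ff_ne⟩

theorem span_sup_span (ht : g.IsOspTriple e f h) :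
    Submodule.span F {h, g.bracket e e, g.bracket f f} ⊔ Submodule.span F {e, f} = ⊤ := by
  rw [← Submodule.span_union]
  set S := Submodule.span F ({h, g.bracket e e, g.bracket f f} ∪ {e, f}) with hS
  have hh : h ∈ S := Submodule.subset_span (by simp)
  have hE : g.bracket e e ∈ S := Submodule.subset_span (by simp)
  have hG : g.bracket f f ∈ S := Submodule.subset_span (by simp)
  have he : e ∈ S := Submodule.subset_span (by simp)
  have hf : f ∈ S := Submodule.subset_span (by simp)
  have key : ∀ x ∈ ({e, f} : Set L), S ≤ S.comap (g.bracket x) := by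
    rintro x (rfl | rfl) <;> rw [hS, Submodule.span_le] <;>
      rintro y ((rfl | rfl | rfl) | (rfl | rfl)) <;> rw [← hS] <;>
      simp only [SetLike.mem_coe, Submodule.mem_comap] <;>
      simp only [ht.eh, ht.ef, ht.fe, ht.fh, ht.f_ee, ht.e_ff,
        g.bracket_self_bracket_self ht.e_mem, g.bracket_self_bracket_self ht.f_mem,
        S.neg_mem_iff, S.smul_mem, S.zero_mem, hh, hE, hG, he, hf]
  have key₂ : ∀ x ∈ ({e, f} : Set L), ∀ y ∈ ({e, f} : Set L), ∀ z ∈ S,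
      g.bracket (g.bracket x y) z ∈ S := by
    intro x hx y hy z hz
    rw [g.bracket_bracket_odd (ht.span_odd_le (Submodule.subset_span hx))
      (ht.span_odd_le (Submodule.subset_span hy))]
    exact S.add_mem (key x hx (key y hy hz)) (key y hy (key x hx hz))
  refine ht.gen S he hf hh fun x hx y hy => ?_
  have hle : S ≤ S.comap (g.bracket.flip y) := by
    conv_lhs => rw [hS]
    rw [Submodule.span_le]
    rintro z ((rfl | rfl | rfl) | hz)
    · simpa [ht.ef] using key₂ e (by simp) f (by simp) y hy
    · exact key₂ e (by simp) e (by simp) y hy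
    · exact key₂ f (by simp) f (by simp) y hy
    · exact key z hz hy
  exact hle hx

theorem carrier_zero (ht : g.IsOspTriple e f h) :
    g.carrier 0 = Submodule.span F {h, g.bracket e e, g.bracket f f} := by
  refine (eq_of_le_of_inf_le_of_sup_le ht.span_even_le (z := g.carrier 1) ?_ ?_).symm
  · simp [g.isCompl.inf_eq_bot]
  · exact le_top.trans (ht.span_sup_span.ge.trans (sup_le_sup_left ht.span_odd_le _))

theorem carrier_one (ht : g.IsOspTriple e f h) : g.carrier 1 = Submodule.span F {e, f} := by
  refine (eq_of_le_of_inf_le_of_sup_le ht.span_odd_le (z := g.carrier 0) ?_ ?_).symm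
  · simp [inf_comm, g.isCompl.inf_eq_bot]
  · rw [sup_comm (Submodule.span F _)]
    exact le_top.trans (ht.span_sup_span.ge.trans (sup_le_sup_right ht.span_even_le _))

/-- The basis `[e,e], e, h, f, [f,f]` of a Lie superalgebra generated by an osp-triple. -/
noncomputable def basis (ht : g.IsOspTriple e f h) : Module.Basis (Fin 5) F L :=
  Module.Basis.mk ht.linearIndependent <| by
    rw [← ht.span_sup_span, ← Submodule.span_union]
    refine Submodule.span_mono ?_
    rintro x ((rfl | rfl | rfl) | (rfl | rfl))
    exacts [⟨2, rfl⟩, ⟨0, rfl⟩, ⟨4, rfl⟩, ⟨1, rfl⟩, ⟨3, rfl⟩]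

/-- Operators satisfying the relations of an osp-triple extend to a representation. -/
theorem exists_representation (ht : g.IsOspTriple e f h) {A : Type*} [Ring A] [Algebra F A]
    {e' f' h' : A}
    (hef : e' * f' + f' * e' = h') (hhe : h' * e' - e' * h' = (2 : F) • e')
    (hhf : h' * f' - f' * h' = -((2 : F) • f')) :
    ∃ ρ : L →ₗ[F] A, ρ e = e' ∧ ρ f = f' ∧ ρ h = h' ∧
      ∀ i j : ZMod 2, ∀ x ∈ g.carrier i, ∀ y ∈ g.carrier j,
        ρ (g.bracket x y) = ρ x * ρ y - ((-1 : F) ^ (i.val * j.val)) • (ρ y * ρ x) := by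
  let ρ : L →ₗ[F] A := ht.basis.constr F ![e' * e' + e' * e', e', h', f', f' * f' + f' * f']
  have hρ (i : Fin 5) : ρ (![g.bracket e e, e, h, f, g.bracket f f] i) =
      ![e' * e' + e' * e', e', h', f', f' * f' + f' * f'] i := by
    have := ht.basis.constr_basis F
      ![e' * e' + e' * e', e', h', f', f' * f' + f' * f'] i
    rwa [basis, Module.Basis.mk_apply] at this
  have hE : ρ (g.bracket e e) = e' * e' + e' * e' := hρ 0
  have he : ρ e = e' := hρ 1
  have hh : ρ h = h' := hρ 2
  have hf : ρ f = f' := hρ 3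
  have hG : ρ (g.bracket f f) = f' * f' + f' * f' := hρ 4
  refine ⟨ρ, he, hf, hh, ?_⟩
  have odd_odd : ∀ x ∈ g.carrier 1, ∀ y ∈ g.carrier 1,
      ρ (g.bracket x y) = ρ x * ρ y + ρ y * ρ x := by
    intro x hx y hy
    rw [ht.carrier_one, Submodule.mem_span_pair] at hx hy
    obtain ⟨a, b, rfl⟩ := hx
    obtain ⟨c, d, rfl⟩ := hy
    simp only [map_add, map_smul, LinearMap.add_apply, LinearMap.smul_apply, ht.ef, ht.fe, hE, he,
      hh, hf, hG, mul_add, add_mul, smul_mul_assoc, mul_smul_comm, ← hef]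
    module
  have odd_even : ∀ x ∈ g.carrier 1, ∀ y ∈ g.carrier 0,
      ρ (g.bracket x y) = ρ x * ρ y - ρ y * ρ x := by
    intro x hx y hy
    rw [ht.carrier_one, Submodule.mem_span_pair] at hx
    rw [ht.carrier_zero, Submodule.mem_span_triple] at hy
    obtain ⟨a, b, rfl⟩ := hx
    obtain ⟨c, d, k, rfl⟩ := hy
    have eG : e' * (f' * f') - f' * f' * e' = -((2 : F) • f') := by
      rw [← hhf, ← hef]; noncomm_ring
    have fE : f' * (e' * e') - e' * e' * f' = (2 : F) • e' := by
      rw [← hhe, ← hef]; noncomm_ring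
    simp only [map_add, map_smul, map_neg, map_zero, LinearMap.add_apply, LinearMap.smul_apply,
      ht.eh, ht.fh, ht.f_ee, ht.e_ff, g.bracket_self_bracket_self ht.e_mem,
      g.bracket_self_bracket_self ht.f_mem, hE, he, hh, hf, hG, mul_add, add_mul, smul_mul_assoc,
      mul_smul_comm]
    rw [mul_assoc e' e' e', mul_assoc f' f' f']
    linear_combination (norm := module) (a * c) • hhe + (b * c) • hhf - (2 * a * k) • eG
      - (2 * b * d) • fE
  have even_aux : ∀ x ∈ g.carrier 1, ∀ x' ∈ g.carrier 1, ∀ j : ZMod 2, ∀ y ∈ g.carrier j,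
      ρ (g.bracket (g.bracket x x') y) =
        ρ (g.bracket x x') * ρ y - ρ y * ρ (g.bracket x x') := by
    intro x hx x' hx' j y hy
    rw [g.bracket_bracket_odd hx hx', map_add, odd_odd x hx x' hx']
    have hxy := g.bracket_mem 1 j x hx y hy
    have hxy' := g.bracket_mem 1 j x' hx' y hy
    fin_cases j
    · rw [odd_odd x hx _ hxy', odd_odd x' hx' _ hxy, odd_even x hx y hy, odd_even x' hx' y hy]
      noncomm_ring
    · rw [odd_even x hx _ hxy', odd_even x' hx' _ hxy, odd_odd x hx y hy, odd_odd x' hx' y hy]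
      noncomm_ring
  have even : ∀ x ∈ g.carrier 0, ∀ j : ZMod 2, ∀ y ∈ g.carrier j,
      ρ (g.bracket x y) = ρ x * ρ y - ρ y * ρ x := by
    intro x hx j y hy
    rw [ht.carrier_zero, Submodule.mem_span_triple] at hx
    obtain ⟨a, b, c, rfl⟩ := hx
    have h₁ := even_aux e ht.e_mem f ht.f_mem j y hy
    have h₂ := even_aux e ht.e_mem e ht.e_mem j y hy
    have h₃ := even_aux f ht.f_mem f ht.f_mem j y hy
    rw [ht.ef] at h₁
    simp only [map_add, map_smul, LinearMap.add_apply, LinearMap.smul_apply, h₁, h₂, h₃, add_mul,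
      mul_add, smul_mul_assoc, mul_smul_comm]
    module
  intro i j x hx y hy
  obtain rfl | rfl := i.eq_zero_or_eq_one_of_two
  · simpa using even x hx j y hy
  · obtain rfl | rfl := j.eq_zero_or_eq_one_of_two
    · simpa using odd_even x hx y hy
    · simpa [ZMod.val_one] using odd_odd x hx y hy

end IsOspTriple

end LieSuperAlgebra

namespace Module.End

variable {e f h : Module.End F V}

theorem commutator_pow {c : F} (hc : h * e - e * h = c • e) (n : ℕ) :
    h * e ^ n - e ^ n * h = (n * c) • e ^ n := by
  induction n with
  | zero => simp
  | succ n ih =>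
    have : h * e ^ (n + 1) - e ^ (n + 1) * h =
        (h * e ^ n - e ^ n * h) * e + e ^ n * (h * e - e * h) := by
      rw [pow_succ]; noncomm_ring
    rw [this, ih, hc, pow_succ, smul_mul_assoc, mul_smul_comm]
    push_cast
    module

/-- A nilpotent operator kills some nonzero element of each stable set with a nonzero element. -/
theorem exists_mem_apply_eq_zero (he : IsNilpotent e) {P : Set V} (heP : ∀ v ∈ P, e v ∈ P)
    {w : V} (hw : w ∈ P) (hw₀ : w ≠ 0) : ∃ v ∈ P, v ≠ 0 ∧ e v = 0 := by
  obtain ⟨n, hn⟩ := he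
  replace hn : (e ^ n) w = 0 := by simp [hn]
  induction n generalizing w with
  | zero => exact absurd hn hw₀
  | succ n ih =>
    by_cases hew : e w = 0
    · exact ⟨w, hw, hw₀, hew⟩
    · exact ih (heP w hw) hew (by rwa [pow_succ] at hn)

theorem h_apply_pow_f (hhf : h * f - f * h = -((2 : F) • f)) (w : V) (i : ℕ) :
    h ((f ^ i) w) = (f ^ i) (h w) - (2 * i : F) • (f ^ i) w := by
  have := congrArg (fun u : Module.End F V => u w)
    (commutator_pow (c := (-2 : F)) (by rw [hhf, neg_smul]) i)
  simp only [LinearMap.sub_apply, Module.End.mul_apply, LinearMap.smul_apply] at this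
  linear_combination (norm := module) this

theorem e_apply_pow_f (hef : e * f + f * e = h) (hhf : h * f - f * h = -((2 : F) • f))
    {w : V} (hw : e w = 0) (k : ℕ) :
    e ((f ^ (2 * k + 1)) w) = (f ^ (2 * k)) (h w) - (2 * k : F) • (f ^ (2 * k)) w ∧
      e ((f ^ (2 * k + 2)) w) = -((2 * k + 2 : F) • (f ^ (2 * k + 1)) w) := by
  have hef' (v : V) : e (f v) = h v - f (e v) := by rw [← hef]; simp
  have step (n : ℕ) : e ((f ^ (n + 1)) w) =
      (f ^ n) (h w) - (2 * n : F) • (f ^ n) w - f (e ((f ^ n) w)) := by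
    rw [pow_succ', Module.End.mul_apply, hef', h_apply_pow_f hhf]
  have next (k : ℕ)
      (h₁ : e ((f ^ (2 * k + 1)) w) = (f ^ (2 * k)) (h w) - (2 * k : F) • (f ^ (2 * k)) w) :
      e ((f ^ (2 * k + 2)) w) = -((2 * k + 2 : F) • (f ^ (2 * k + 1)) w) := by
    rw [step (2 * k + 1), h₁, pow_succ']
    simp only [map_sub, map_smul, Module.End.mul_apply]
    push_cast
    module
  suffices h₁ : e ((f ^ (2 * k + 1)) w) = (f ^ (2 * k)) (h w) - (2 * k : F) • (f ^ (2 * k)) w from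
    ⟨h₁, next k h₁⟩
  induction k with
  | zero => simp [hef', hw]
  | succ k ih =>
    rw [step, mul_add, mul_one, next k ih, pow_succ' f (2 * k + 1)]
    simp only [map_neg, map_smul, Module.End.mul_apply]
    push_cast
    module

variable [CharZero F]

theorem isNilpotent_of_commutator_eq_smul [FiniteDimensional F V] {c : F} (hc₀ : c ≠ 0)
    (hc : h * e - e * h = c • e) : IsNilpotent e := by
  by_contra hn
  rw [IsNilpotent, not_exists] at hn
  let D : Module.End F (Module.End F V) := LinearMap.mulLeft F h - LinearMap.mulRight F h
  have hD (n : ℕ) : D.HasEigenvalue (n * c) := by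
    refine Module.End.hasEigenvalue_of_hasEigenvector (x := e ^ n) ?_
    rw [Module.End.hasEigenvector_iff, Module.End.mem_eigenspace_iff]
    exact ⟨commutator_pow hc n, hn n⟩
  refine Set.infinite_of_injective_forall_mem (f := fun n : ℕ => (n : F) * c) ?_ hD
    D.finite_hasEigenvalue
  intro m n hmn
  exact_mod_cast mul_right_cancel₀ hc₀ hmn

/-- Existence of a homogeneous highest weight vector of even natural weight `2 * k`. -/
theorem exists_highest_weight_vector [FiniteDimensional F V] [Nontrivial V]
    (hef : e * f + f * e = h) (hhe : h * e - e * h = (2 : F) • e)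
    (hhf : h * f - f * h = -((2 : F) • f))
    {C : ZMod 2 → Submodule F V} (hC : C 0 ⊔ C 1 = ⊤)
    (heC : ∀ j, ∀ v ∈ C j, e v ∈ C (1 + j)) (hhC : ∀ j, ∀ v ∈ C j, h v ∈ C j) :
    ∃ p, ∃ w ∈ C p, ∃ k : ℕ, e w = 0 ∧ h w = (2 * k : F) • w ∧ (f ^ (2 * k + 1)) w = 0 ∧
      ∀ i ≤ 2 * k, (f ^ i) w ≠ 0 := by
  classical
  have hex : ∃ n, ∃ p, ∃ w ∈ C p, w ≠ 0 ∧ e w = 0 ∧ (f ^ n) w = 0 := by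
    obtain ⟨n, hn⟩ := isNilpotent_of_commutator_eq_smul (c := (-2 : F)) (by norm_num)
      (by rw [hhf, neg_smul])
    obtain ⟨p, v, hv, hv₀⟩ : ∃ p, ∃ v ∈ C p, v ≠ 0 := by
      by_contra! hcon
      have h0 : C 0 = ⊥ := (Submodule.eq_bot_iff _).2 (hcon 0)
      have h1 : C 1 = ⊥ := (Submodule.eq_bot_iff _).2 (hcon 1)
      rw [h0, h1, sup_bot_eq] at hC
      exact bot_ne_top hC
    obtain ⟨w, ⟨p, hw⟩, hw₀, hew⟩ :=
      exists_mem_apply_eq_zero (isNilpotent_of_commutator_eq_smul two_ne_zero hhe)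
        (P := {v | ∃ p, v ∈ C p}) (fun v ⟨p, hv⟩ => ⟨1 + p, heC p v hv⟩) ⟨p, hv⟩ hv₀
    exact ⟨n, p, w, hw, hw₀, hew, by simp [hn]⟩
  obtain ⟨p, w, hw, hw₀, hew, hfw⟩ := Nat.find_spec hex
  have hmin (i : ℕ) (hi : i < Nat.find hex) {u : V} (hu : u ∈ C p) (heu : e u = 0)
      (hfu : (f ^ i) u = 0) : u = 0 := by
    by_contra hu₀
    exact Nat.find_min hex hi ⟨p, u, hu, hu₀, heu, hfu⟩
  generalize Nat.find hex = n at hfw hmin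
  obtain ⟨k, rfl | rfl⟩ := n.even_or_odd'
  · obtain _ | k := k
    · exact absurd hfw hw₀
    · have h₁ := (e_apply_pow_f hef hhf hew k).2
      rw [mul_add, mul_one] at hfw
      rw [hfw, map_zero, eq_comm, neg_eq_zero, smul_eq_zero] at h₁
      have h₂ := h₁.resolve_left (by exact_mod_cast Nat.succ_ne_zero (2 * k + 1))
      exact absurd (hmin (2 * k + 1) (by omega) hw hew h₂) hw₀
  · refine ⟨p, w, hw, k, hew, ?_, hfw, fun i hi hfi => hw₀ (hmin i (by omega) hw hew hfi)⟩
    have h₁ := (e_apply_pow_f hef hhf hew k).1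
    rw [hfw, map_zero, ← map_smul, ← map_sub] at h₁
    have hhw : h w - (2 * k : F) • w ∈ C p :=
      (C p).sub_mem (hhC p w hw) ((C p).smul_mem _ hw)
    refine sub_eq_zero.1 (hmin (2 * k) (by omega) hhw ?_ h₁.symm)
    have h₂ : e (h w) = 0 := by
      have := congrArg (fun u : Module.End F V => u w) hhe
      simpa [hew] using this
    simp [h₂, hew]

end Module.End

section WeightString

/-- The coefficient of `e v_i` on `v_{i-1}` in the standard module of highest weight `lam`. -/
def raisingCoeff (F : Type) [Field F] (lam i : ℕ) : F :=
  if Even i then -(i : F) else (lam : F) - ((i : F) - 1)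

theorem raisingCoeff_ne_zero [CharZero F] {lam i : ℕ} (hi : i + 1 ≤ lam) :
    raisingCoeff F lam (i + 1) ≠ 0 := by
  unfold raisingCoeff
  split_ifs
  · exact neg_ne_zero.2 (Nat.cast_ne_zero.2 i.succ_ne_zero)
  · push_cast
    rw [add_sub_cancel_right, sub_ne_zero]
    exact_mod_cast (by omega : lam ≠ i)

theorem raisingCoeff_add_raisingCoeff (lam i : ℕ) :
    raisingCoeff F lam (i + 1) + raisingCoeff F lam i = lam - 2 * i := by
  unfold raisingCoeff
  by_cases hi : Even i
  · rw [if_neg (by simpa [Nat.even_add_one] using hi), if_pos hi]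
    push_cast
    ring
  · rw [if_pos (by simpa [Nat.even_add_one] using hi), if_neg hi]
    push_cast
    ring

/-- A sequence of vectors on which `e`, `f`, `h` act by the standard formulas of highest weight
`lam`. -/
structure IsWeightString (e f h : Module.End F V) (lam : ℕ) (b : ℕ → V) : Prop where
  f_apply (i : ℕ) : f (b i) = b (i + 1)
  h_apply (i : ℕ) : h (b i) = ((lam : F) - 2 * i) • b i
  e_zero : e (b 0) = 0
  e_succ (i : ℕ) : e (b (i + 1)) = raisingCoeff F lam (i + 1) • b i
  ne_zero : ∀ i ≤ lam, b i ≠ 0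
  eq_zero : ∀ i, lam < i → b i = 0

namespace IsWeightString

variable {e f h : Module.End F V} {lam : ℕ} {b : ℕ → V}

theorem of_highest_weight_vector (hef : e * f + f * e = h)
    (hhf : h * f - f * h = -((2 : F) • f)) {w : V} {k : ℕ} (hew : e w = 0)
    (hhw : h w = (2 * k : F) • w) (hfw : (f ^ (2 * k + 1)) w = 0)
    (hne : ∀ i ≤ 2 * k, (f ^ i) w ≠ 0) :
    IsWeightString e f h (2 * k) (fun i => (f ^ i) w) where
  f_apply i := by rw [pow_succ', Module.End.mul_apply]
  h_apply i := by
    rw [Module.End.h_apply_pow_f hhf, hhw, map_smul]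
    push_cast
    module
  e_zero := by simpa using hew
  e_succ i := by
    obtain ⟨j, rfl | rfl⟩ := i.even_or_odd'
    · rw [(Module.End.e_apply_pow_f hef hhf hew j).1, hhw, map_smul, raisingCoeff,
        if_neg (by simp)]
      push_cast
      module
    · rw [(Module.End.e_apply_pow_f hef hhf hew j).2, raisingCoeff,
        if_pos (by simp [Nat.even_add_one])]
      push_cast
      module
  ne_zero := hne
  eq_zero i hi := by
    obtain ⟨d, rfl⟩ := Nat.exists_eq_add_of_lt hi
    rw [show 2 * k + d + 1 = d + (2 * k + 1) by ring, pow_add, Module.End.mul_apply, hfw, map_zero]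

theorem twist (hb : IsWeightString e f h lam b) {s : F} (hs : s * s = 1) :
    IsWeightString (s • e) (s • f) h lam (fun i => s ^ i • b i) where
  f_apply i := by
    rw [LinearMap.smul_apply, map_smul, hb.f_apply, smul_smul, pow_succ']
  h_apply i := by rw [map_smul, hb.h_apply, smul_comm]
  e_zero := by simp [hb.e_zero]
  e_succ i := by
    rw [LinearMap.smul_apply, map_smul, hb.e_succ, smul_smul, smul_smul, smul_smul, pow_succ]
    congr 1
    linear_combination s ^ i * raisingCoeff F lam (i + 1) * hs
  ne_zero i hi := smul_ne_zero (pow_ne_zero _ (left_ne_zero_of_mul_eq_one hs)) (hb.ne_zero i hi)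
  eq_zero i hi := by rw [hb.eq_zero i hi, smul_zero]

theorem linearIndependent (hb : IsWeightString e f h lam b) [CharZero F] :
    LinearIndependent F (fun i : Fin (lam + 1) => b i) := by
  refine Module.End.eigenvectors_linearIndependent' h
    (fun i : Fin (lam + 1) => (lam : F) - 2 * (i : ℕ)) ?_ _ ?_
  · intro i j hij
    simpa [Fin.ext_iff] using hij
  · intro i
    rw [Module.End.hasEigenvector_iff, Module.End.mem_eigenspace_iff]
    exact ⟨hb.h_apply i, hb.ne_zero i (by omega)⟩

theorem mem_span (hb : IsWeightString e f h lam b) (i : ℕ) :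
    b i ∈ Submodule.span F (Set.range fun i : Fin (lam + 1) => b i) := by
  by_cases hi : i ≤ lam
  · exact Submodule.subset_span ⟨⟨i, by omega⟩, rfl⟩
  · rw [hb.eq_zero i (by omega)]
    exact Submodule.zero_mem _

theorem ext_of_span
    (hspan : Submodule.span F (Set.range fun i : Fin (lam + 1) => b i) = ⊤)
    {W : Type} [AddCommGroup W] [Module F W] {φ ψ : V →ₗ[F] W}
    (H : ∀ i, φ (b i) = ψ (b i)) : φ = ψ :=
  LinearMap.ext_on_range hspan fun i => H i

theorem relation_ef (hb : IsWeightString e f h lam b)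
    (hspan : Submodule.span F (Set.range fun i : Fin (lam + 1) => b i) = ⊤) :
    e * f + f * e = h := by
  refine ext_of_span hspan fun i => ?_
  simp only [LinearMap.add_apply, Module.End.mul_apply, hb.f_apply, hb.e_succ, hb.h_apply,
    ← raisingCoeff_add_raisingCoeff]
  cases i with
  | zero => simp [hb.e_zero, raisingCoeff]
  | succ i => rw [hb.e_succ, map_smul, hb.f_apply, add_smul]

theorem relation_he (hb : IsWeightString e f h lam b)
    (hspan : Submodule.span F (Set.range fun i : Fin (lam + 1) => b i) = ⊤) :
    h * e - e * h = (2 : F) • e := by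
  refine ext_of_span hspan fun i => ?_
  cases i with
  | zero => simp [hb.e_zero, hb.h_apply]
  | succ i =>
    simp only [LinearMap.sub_apply, Module.End.mul_apply, LinearMap.smul_apply, hb.e_succ,
      hb.h_apply, map_smul]
    push_cast
    module

theorem relation_hf (hb : IsWeightString e f h lam b)
    (hspan : Submodule.span F (Set.range fun i : Fin (lam + 1) => b i) = ⊤) :
    h * f - f * h = -((2 : F) • f) := by
  refine ext_of_span hspan fun i => ?_
  simp only [LinearMap.sub_apply, Module.End.mul_apply, LinearMap.smul_apply, LinearMap.neg_apply,
    hb.f_apply, hb.h_apply, map_smul]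
  push_cast
  module

theorem pow_f_eq_zero (hb : IsWeightString e f h lam b)
    (hspan : Submodule.span F (Set.range fun i : Fin (lam + 1) => b i) = ⊤) :
    f ^ (lam + 1) = 0 := by
  have hpow (n i : ℕ) : (f ^ n) (b i) = b (i + n) := by
    induction n with
    | zero => simp
    | succ n ih => rw [pow_succ', Module.End.mul_apply, ih, hb.f_apply, add_assoc]
  exact ext_of_span hspan fun i => by
    rw [hpow, hb.eq_zero _ (by omega), LinearMap.zero_apply]

variable [CharZero F]

/-- The basis given by a spanning weight string. -/
noncomputable def basis (hb : IsWeightString e f h lam b)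
    (hspan : Submodule.span F (Set.range fun i : Fin (lam + 1) => b i) = ⊤) :
    Module.Basis (Fin (lam + 1)) F V :=
  Module.Basis.mk hb.linearIndependent hspan.ge

theorem basis_apply (hb : IsWeightString e f h lam b)
    (hspan : Submodule.span F (Set.range fun i : Fin (lam + 1) => b i) = ⊤)
    (i : Fin (lam + 1)) : hb.basis hspan i = b i := by
  simp [basis]

theorem finrank_eq (hb : IsWeightString e f h lam b)
    (hspan : Submodule.span F (Set.range fun i : Fin (lam + 1) => b i) = ⊤) :
    Module.finrank F V = lam + 1 := by
  simpa using Module.finrank_eq_card_basis (hb.basis hspan)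

theorem last_mem_of_mem (hb : IsWeightString e f h lam b)
    (hspan : Submodule.span F (Set.range fun i : Fin (lam + 1) => b i) = ⊤)
    {W : Submodule F V} {u : V} (hu : u ∈ W) (hu₀ : u ≠ 0) (hfu : f u = 0) :
    b lam ∈ W := by
  have hrepr := (hb.basis hspan).sum_repr u
  simp only [basis_apply, Fin.sum_univ_castSucc, Fin.val_castSucc, Fin.val_last] at hrepr
  set c := (hb.basis hspan).repr u
  have hind := (hb.linearIndependent.comp Fin.succ (Fin.succ_injective _))
  rw [Fintype.linearIndependent_iff] at hind
  have hc : ∀ i : Fin lam, c i.castSucc = 0 := by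
    refine hind (fun i => c i.castSucc) ?_
    rw [← hrepr] at hfu
    simpa [hb.f_apply, hb.eq_zero (lam + 1) (by omega)] using hfu
  simp only [hc, zero_smul, Finset.sum_const_zero, zero_add] at hrepr
  rw [← hrepr] at hu hu₀
  exact (W.smul_mem_iff (left_ne_zero_of_smul hu₀)).1 hu

theorem eq_bot_or_eq_top (hb : IsWeightString e f h lam b)
    (hspan : Submodule.span F (Set.range fun i : Fin (lam + 1) => b i) = ⊤)
    {W : Submodule F V} (heW : ∀ v ∈ W, e v ∈ W) (hfW : ∀ v ∈ W, f v ∈ W) :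
    W = ⊥ ∨ W = ⊤ := by
  rw [or_iff_not_imp_left]
  intro hW
  obtain ⟨v, hv, hv₀⟩ := W.ne_bot_iff.1 hW
  obtain ⟨u, hu, hu₀, hfu⟩ := Module.End.exists_mem_apply_eq_zero
    ⟨_, hb.pow_f_eq_zero hspan⟩ (P := W) hfW hv hv₀
  have hmem (d : ℕ) : ∀ i, i + d = lam → b i ∈ W := by
    induction d with
    | zero =>
      rintro i rfl
      exact hb.last_mem_of_mem hspan hu hu₀ hfu
    | succ d ih =>
      intro i hi
      have := heW _ (ih (i + 1) (by omega))
      rw [hb.e_succ] at this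
      exact (W.smul_mem_iff (raisingCoeff_ne_zero (by omega))).1 this
  rw [eq_top_iff, ← hspan, Submodule.span_le]
  rintro _ ⟨i, rfl⟩
  exact hmem (lam - i) i (by omega)

end IsWeightString

end WeightString

namespace LieSuperModule

section

variable {g : LieSuperAlgebra F L} (M : LieSuperModule g V) {e f h : L}

theorem act_bracket_odd_s5 {x y : L} (hx : x ∈ g.carrier 1) (hy : y ∈ g.carrier 1) :
    M.act (g.bracket x y) = M.act x * M.act y + M.act y * M.act x := by
  ext v
  simpa [ZMod.val_one] using M.bracket_act 1 1 x hx y hy v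

theorem act_bracket_even {j : ZMod 2} {x y : L} (hx : x ∈ g.carrier 0) (hy : y ∈ g.carrier j) :
    M.act (g.bracket x y) = M.act x * M.act y - M.act y * M.act x := by
  ext v
  simpa using M.bracket_act 0 j x hx y hy v

theorem act_ef (ht : g.IsOspTriple e f h) : M.act e * M.act f + M.act f * M.act e = M.act h := by
  rw [← M.act_bracket_odd_s5 ht.e_mem ht.f_mem, ht.ef]

theorem act_he (ht : g.IsOspTriple e f h) :
    M.act h * M.act e - M.act e * M.act h = (2 : F) • M.act e := by
  rw [← M.act_bracket_even ht.h_mem ht.e_mem, ht.he, map_smul]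

theorem act_hf (ht : g.IsOspTriple e f h) :
    M.act h * M.act f - M.act f * M.act h = -((2 : F) • M.act f) := by
  rw [← M.act_bracket_even ht.h_mem ht.f_mem, ht.hf, map_neg, map_smul]

variable [CharZero F]

theorem exists_act_odd (ht : g.IsOspTriple e f h) {x : L} (hx : x ∈ g.carrier 1) :
    ∃ a b : F, M.act x = a • M.act e + b • M.act f := by
  rw [ht.carrier_one, Submodule.mem_span_pair] at hx
  obtain ⟨a, b, rfl⟩ := hx
  exact ⟨a, b, by simp⟩

theorem exists_act_even (ht : g.IsOspTriple e f h) {x : L} (hx : x ∈ g.carrier 0) :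
    ∃ a b c : F, M.act x = a • M.act h + b • (M.act e * M.act e) + c • (M.act f * M.act f) := by
  rw [ht.carrier_zero, Submodule.mem_span_triple] at hx
  obtain ⟨a, b, c, rfl⟩ := hx
  refine ⟨a, 2 * b, 2 * c, ?_⟩
  simp only [map_add, map_smul, M.act_bracket_odd_s5 ht.e_mem ht.e_mem,
    M.act_bracket_odd_s5 ht.f_mem ht.f_mem]
  module

theorem act_mem_of_generators (ht : g.IsOspTriple e f h) {W : Submodule F V}
    (heW : ∀ v ∈ W, M.act e v ∈ W)
    (hfW : ∀ v ∈ W, M.act f v ∈ W) (x : L) {v : V} (hv : v ∈ W) : M.act x v ∈ W := by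
  have hhW : M.act h v ∈ W := by
    rw [← M.act_ef ht]
    exact W.add_mem (heW _ (hfW v hv)) (hfW _ (heW v hv))
  obtain ⟨y, hy, z, hz, rfl⟩ :=
    Submodule.mem_sup.1 (g.isCompl.sup_eq_top.ge (Submodule.mem_top (x := x)))
  obtain ⟨a, b, c, hy⟩ := M.exists_act_even ht hy
  obtain ⟨a', b', hz⟩ := M.exists_act_odd ht hz
  rw [map_add, hy, hz]
  exact W.add_mem (W.add_mem (W.add_mem (W.smul_mem _ hhW) (W.smul_mem _ (heW _ (heW v hv))))
    (W.smul_mem _ (hfW _ (hfW v hv))))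
    (W.add_mem (W.smul_mem _ (heW v hv)) (W.smul_mem _ (hfW v hv)))

/-- A finite-dimensional irreducible module is spanned by a homogeneous weight string. -/
theorem IsIrreducible.exists_isWeightString (ht : g.IsOspTriple e f h) [FiniteDimensional F V]
    {M : LieSuperModule g V} (hM : M.IsIrreducible) :
    ∃ (k : ℕ) (p : ZMod 2) (b : ℕ → V),
      IsWeightString (M.act e) (M.act f) (M.act h) (2 * k) b ∧
      (∀ i : ℕ, b i ∈ M.carrier (i + p)) ∧
      Submodule.span F (Set.range fun i : Fin (2 * k + 1) => b i) = ⊤ := by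
  obtain ⟨v, hv⟩ := hM.1
  have : Nontrivial V := ⟨v, 0, hv⟩
  obtain ⟨p, w, hw, k, hew, hhw, hfw, hne⟩ := Module.End.exists_highest_weight_vector
    (M.act_ef ht) (M.act_he ht) (M.act_hf ht) M.isCompl.sup_eq_top
    (fun j => M.act_mem 1 j e ht.e_mem)
    (fun j v hv => by simpa using M.act_mem 0 j h ht.h_mem v hv)
  have hb := IsWeightString.of_highest_weight_vector (M.act_ef ht) (M.act_hf ht) hew hhw hfw hne
  generalize hbw : (fun i => (M.act f ^ i) w) = b at hb
  have hbC (i : ℕ) : b i ∈ M.carrier (i + p) := by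
    induction i with
    | zero => simpa [← hbw] using hw
    | succ i ih =>
      rw [← hb.f_apply, Nat.cast_succ, add_comm (i : ZMod 2), add_assoc]
      exact M.act_mem 1 _ f ht.f_mem _ ih
  refine ⟨k, p, b, hb, hbC, ?_⟩
  set W := Submodule.span F (Set.range fun i : Fin (2 * k + 1) => b i) with hW
  have heW : W ≤ W.comap (M.act e) := by
    conv_lhs => rw [hW]
    rw [Submodule.span_le]
    rintro _ ⟨⟨i, hi⟩, rfl⟩
    change M.act e (b i) ∈ W
    cases i with
    | zero => simp [hb.e_zero]
    | succ i =>
      rw [hb.e_succ]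
      exact W.smul_mem _ (hb.mem_span i)
  have hfW : W ≤ W.comap (M.act f) := by
    conv_lhs => rw [hW]
    rw [Submodule.span_le]
    rintro _ ⟨i, rfl⟩
    change M.act f (b i) ∈ W
    rw [hb.f_apply]
    exact hb.mem_span _
  refine (hM.2 W ⟨?_, fun x v hv => M.act_mem_of_generators ht heW hfW x hv⟩).resolve_left ?_
  · conv_lhs => rw [hW]
    rw [Submodule.span_le]
    rintro _ ⟨i, rfl⟩
    have hi := hbC i
    have hiW := hb.mem_span i
    obtain h₀ | h₁ := ((i : ℕ) + p : ZMod 2).eq_zero_or_eq_one_of_two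
    · rw [h₀] at hi
      exact Submodule.mem_sup_left ⟨hiW, hi⟩
    · rw [h₁] at hi
      exact Submodule.mem_sup_right ⟨hiW, hi⟩
  · exact W.ne_bot_iff.2 ⟨b 0, hb.mem_span 0, hb.ne_zero 0 (Nat.zero_le _)⟩

theorem isIrreducible_of_isWeightString {lam : ℕ} {b : ℕ → V}
    (hb : IsWeightString (M.act e) (M.act f) (M.act h) lam b)
    (hspan : Submodule.span F (Set.range fun i : Fin (lam + 1) => b i) = ⊤) :
    M.IsIrreducible :=
  ⟨⟨b 0, hb.ne_zero 0 (Nat.zero_le _)⟩,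
    fun _ hW => hb.eq_bot_or_eq_top hspan (hW.2 e) (hW.2 f)⟩

end

section

variable {g : LieSuperAlgebra F L} {W : Type} [AddCommGroup W] [Module F W]
  {M : LieSuperModule g V} {N : LieSuperModule g W}

/-- A linear equivalence mapping a grading into a grading maps it onto that grading. -/
theorem map_carrier_eq (φ : V ≃ₗ[F] W) {p : ZMod 2}
    (hφ : ∀ j, Submodule.map (φ : V →ₗ[F] W) (M.carrier j) ≤ N.carrier (j + p)) (j : ZMod 2) :
    Submodule.map (φ : V →ₗ[F] W) (M.carrier j) = N.carrier (j + p) := by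
  have hM : M.carrier j ⊔ M.carrier (j + 1) = ⊤ := by
    obtain rfl | rfl := j.eq_zero_or_eq_one_of_two
    · exact M.isCompl.sup_eq_top
    · rw [sup_comm]
      exact M.isCompl.sup_eq_top
  have hN : N.carrier (j + p) ⊓ N.carrier (j + 1 + p) = ⊥ := by
    rw [add_right_comm]
    obtain h₀ | h₀ := (j + p).eq_zero_or_eq_one_of_two <;> rw [h₀]
    · exact N.isCompl.inf_eq_bot
    · rw [inf_comm]
      exact N.isCompl.inf_eq_bot
  refine eq_of_le_of_inf_le_of_sup_le (hφ j) (z := N.carrier (j + 1 + p)) ?_ ?_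
  · simp [hN]
  · refine le_top.trans (le_trans ?_ (sup_le_sup_left (hφ (j + 1)) _))
    rw [← Submodule.map_sup, hM, Submodule.map_top, LinearEquiv.range]

variable [CharZero F] {e f h : L} {lam : ℕ} {b : ℕ → V} {b' : ℕ → W}

theorem iso_of_isWeightString [FiniteDimensional F W] (ht : g.IsOspTriple e f h)
    (hb : IsWeightString (M.act e) (M.act f) (M.act h) lam b)
    (hspan : Submodule.span F (Set.range fun i : Fin (lam + 1) => b i) = ⊤)
    (hM : ∀ j, M.carrier j =
      Submodule.span F {v | ∃ i : Fin (lam + 1), ((i : ℕ) : ZMod 2) = j ∧ v = b i})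
    (hb' : IsWeightString (N.act e) (N.act f) (N.act h) lam b')
    (hdim : Module.finrank F W = lam + 1) {p : ZMod 2} (hN : ∀ i : ℕ, b' i ∈ N.carrier (i + p)) :
    M.Iso N := by
  set s : F := (-1) ^ p.val with hs
  have hss : s * s = 1 := by rw [hs, ← mul_pow]; simp
  have hb'' := hb'.twist hss
  have hspan' : Submodule.span F (Set.range fun i : Fin (lam + 1) => s ^ (i : ℕ) • b' i) = ⊤ :=
    hb''.linearIndependent.span_eq_top_of_card_eq_finrank' (by simp [hdim])
  let φ : V ≃ₗ[F] W := (hb.basis hspan).equiv (hb''.basis hspan') (Equiv.refl _)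
  have hφ (i : ℕ) : φ (b i) = s ^ i • b' i := by
    by_cases hi : i < lam + 1
    · have := (hb.basis hspan).equiv_apply ⟨i, hi⟩ (hb''.basis hspan') (Equiv.refl _)
      simpa only [IsWeightString.basis_apply, Equiv.refl_apply] using this
    · rw [hb.eq_zero i (by omega), hb'.eq_zero i (by omega), map_zero, smul_zero]
  have hφe (v : V) : φ (M.act e v) = s • N.act e (φ v) := by
    refine LinearMap.congr_fun (f := φ.toLinearMap ∘ₗ M.act e)
      (g := (s • N.act e) ∘ₗ φ.toLinearMap) (IsWeightString.ext_of_span hspan fun i => ?_) v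
    cases i with
    | zero => simpa [hb.e_zero, hφ] using hb''.e_zero.symm
    | succ i =>
      rw [LinearMap.comp_apply, LinearMap.comp_apply, LinearEquiv.coe_coe, hφ, hb.e_succ, map_smul,
        hφ]
      exact (hb''.e_succ i).symm
  have hφf (v : V) : φ (M.act f v) = s • N.act f (φ v) := by
    refine LinearMap.congr_fun (f := φ.toLinearMap ∘ₗ M.act f)
      (g := (s • N.act f) ∘ₗ φ.toLinearMap) (IsWeightString.ext_of_span hspan fun i => ?_) v
    simp only [LinearMap.comp_apply, LinearEquiv.coe_coe, hφ, hb.f_apply]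
    exact (hb''.f_apply i).symm
  have hφh (v : V) : φ (M.act h v) = N.act h (φ v) := by
    simp only [← M.act_ef ht, ← N.act_ef ht, LinearMap.add_apply, Module.End.mul_apply, map_add,
      hφe, hφf, map_smul, smul_smul, hss, one_smul]
  refine ⟨φ, p, map_carrier_eq φ fun j => ?_, fun i x hx v => ?_⟩
  · rw [hM j, Submodule.map_span_le]
    rintro _ ⟨i, rfl, rfl⟩
    rw [LinearEquiv.coe_coe, hφ]
    exact Submodule.smul_mem _ _ (hN i)
  · obtain rfl | rfl := i.eq_zero_or_eq_one_of_two
    · rw [ht.carrier_zero, Submodule.mem_span_triple] at hx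
      obtain ⟨a, b, c, rfl⟩ := hx
      simp only [map_add, map_smul, M.act_bracket_odd_s5 ht.e_mem ht.e_mem,
        M.act_bracket_odd_s5 ht.f_mem ht.f_mem, N.act_bracket_odd_s5 ht.e_mem ht.e_mem,
        N.act_bracket_odd_s5 ht.f_mem ht.f_mem, LinearMap.add_apply, LinearMap.smul_apply,
        Module.End.mul_apply, hφe, hφf, hφh, smul_smul, hss]
      simp
    · rw [ht.carrier_one, Submodule.mem_span_pair] at hx
      obtain ⟨a, b, rfl⟩ := hx
      rw [ZMod.val_one, one_mul, ← hs]
      simp only [map_add, map_smul, LinearMap.add_apply, LinearMap.smul_apply, hφe, hφf]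
      module

end

end LieSuperModule

section StandardModule

/-- The sequence `v_0, …, v_lam, 0, 0, …` of standard basis vectors. -/
def standardVector (F : Type) [Field F] (lam i : ℕ) : Fin (lam + 1) → F :=
  if hi : i < lam + 1 then Pi.single ⟨i, hi⟩ 1 else 0

theorem standardVector_coe (lam : ℕ) (i : Fin (lam + 1)) :
    standardVector F lam i = Pi.single i 1 := by
  simp only [standardVector, i.is_lt, dif_pos]

theorem standardVector_eq_zero {lam i : ℕ} (hi : lam < i) : standardVector F lam i = 0 :=
  dif_neg (by omega)

theorem span_standardVector (lam : ℕ) :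
    Submodule.span F (Set.range fun i : Fin (lam + 1) => standardVector F lam i) = ⊤ := by
  simp only [standardVector_coe]
  have := (Pi.basisFun F (Fin (lam + 1))).span_eq
  rwa [funext (Pi.basisFun_apply F (Fin (lam + 1)))] at this

theorem exists_isWeightString_standardVector [CharZero F] {lam : ℕ} (hlam : Even lam) :
    ∃ e f h : Module.End F (Fin (lam + 1) → F),
      IsWeightString e f h lam (standardVector F lam) := by
  let B := Pi.basisFun F (Fin (lam + 1))
  have hB (φ : Fin (lam + 1) → Fin (lam + 1) → F) (i : Fin (lam + 1)) :
      B.constr F φ (standardVector F lam i) = φ i := by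
    have := B.constr_basis F φ i
    rwa [Pi.basisFun_apply, ← standardVector_coe] at this
  refine ⟨B.constr F fun i => raisingCoeff F lam i • standardVector F lam (i - 1),
    B.constr F fun i => standardVector F lam (i + 1),
    B.constr F fun i => ((lam : F) - 2 * (i : ℕ)) • standardVector F lam i, ?_⟩
  constructor
  · intro i
    by_cases hi : i < lam + 1
    · exact hB _ ⟨i, hi⟩
    · rw [standardVector_eq_zero (by omega), standardVector_eq_zero (by omega), map_zero]
  · intro i
    by_cases hi : i < lam + 1
    · exact hB _ ⟨i, hi⟩
    · rw [standardVector_eq_zero (by omega), map_zero, smul_zero]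
  · refine (hB _ 0).trans ?_
    simp [raisingCoeff]
  · intro i
    by_cases hi : i + 1 < lam + 1
    · exact hB _ ⟨i + 1, hi⟩
    · rw [standardVector_eq_zero (by omega), map_zero]
      obtain rfl | hi := eq_or_lt_of_le (show lam ≤ i by omega)
      · rw [raisingCoeff, if_neg (by simpa [Nat.even_add_one] using hlam)]
        simp
      · rw [standardVector_eq_zero hi, smul_zero]
  · intro i hi
    simp [standardVector, show i < lam + 1 by omega]
  · exact fun i => standardVector_eq_zero

/-- The span of the standard basis vectors whose index has parity `j`. -/
def standardGrading (F : Type) [Field F] (lam : ℕ) (j : ZMod 2) :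
    Submodule F (Fin (lam + 1) → F) :=
  Submodule.span F {v | ∃ i : Fin (lam + 1), ((i : ℕ) : ZMod 2) = j ∧ v = standardVector F lam i}

theorem standardVector_mem (lam i : ℕ) : standardVector F lam i ∈ standardGrading F lam i := by
  by_cases hi : i < lam + 1
  · exact Submodule.subset_span ⟨⟨i, hi⟩, rfl, rfl⟩
  · rw [standardVector_eq_zero (by omega)]
    exact Submodule.zero_mem _

theorem isCompl_standardGrading (lam : ℕ) :
    IsCompl (standardGrading F lam 0) (standardGrading F lam 1) := by
  have himage (j : ZMod 2) : standardGrading F lam j =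
      Submodule.span F (Pi.basisFun F (Fin (lam + 1)) '' {i | ((i : ℕ) : ZMod 2) = j}) := by
    rw [standardGrading]
    congr 1
    ext v
    simp [standardVector_coe, eq_comm]
  rw [himage, himage]
  refine (Pi.basisFun F _).linearIndependent.isCompl_span_image (Pi.basisFun F _).span_eq ?_
  rw [isCompl_iff, Set.disjoint_left, codisjoint_iff_le_sup]
  constructor
  · intro i (hi : _ = _) (hi' : _ = _)
    rw [hi] at hi'
    exact zero_ne_one hi'
  · exact fun i _ => ((i : ℕ) : ZMod 2).eq_zero_or_eq_one_of_two

theorem IsWeightString.standardGrading_le {lam : ℕ} {e f h : Module.End F (Fin (lam + 1) → F)}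
    (hb : IsWeightString e f h lam (standardVector F lam)) (j : ZMod 2) :
    standardGrading F lam j ≤ (standardGrading F lam (1 + j)).comap e ∧
    standardGrading F lam j ≤ (standardGrading F lam (1 + j)).comap f ∧
    standardGrading F lam j ≤ (standardGrading F lam j).comap h := by
  refine ⟨?_, ?_, ?_⟩ <;> refine Submodule.span_le.2 ?_ <;> rintro _ ⟨⟨i, hi⟩, rfl, rfl⟩ <;>
    rw [SetLike.mem_coe, Submodule.mem_comap]
  · cases i with
    | zero => simp [hb.e_zero]
    | succ i =>
      rw [hb.e_succ]
      have h₂ : (1 + ((i + 1 : ℕ) : ZMod 2)) = i := by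
        push_cast
        linear_combination (by decide : (1 + 1 : ZMod 2) = 0)
      rw [h₂]
      exact Submodule.smul_mem _ _ (standardVector_mem lam i)
  · rw [hb.f_apply]
    simpa [add_comm] using standardVector_mem (F := F) lam (i + 1)
  · rw [hb.h_apply]
    exact Submodule.smul_mem _ _ (standardVector_mem lam i)

/-- The standard module of even highest weight `lam`. -/
theorem LieSuperAlgebra.IsOspTriple.exists_standardModule [CharZero F] {g : LieSuperAlgebra F L}
    {e f h : L} (ht : g.IsOspTriple e f h) {lam : ℕ} (hlam : Even lam) :
    ∃ M : LieSuperModule g (Fin (lam + 1) → F), M.carrier = standardGrading F lam ∧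
      IsWeightString (M.act e) (M.act f) (M.act h) lam (standardVector F lam) := by
  obtain ⟨e', f', h', hb⟩ := exists_isWeightString_standardVector (F := F) hlam
  have hspan := span_standardVector (F := F) lam
  obtain ⟨ρ, rfl, rfl, rfl, hρ⟩ := ht.exists_representation (hb.relation_ef hspan)
    (hb.relation_he hspan) (hb.relation_hf hspan)
  refine ⟨⟨ρ, standardGrading F lam, isCompl_standardGrading lam, ?_, ?_⟩, rfl, hb⟩
  · intro i j x hx v hv
    have heC (j : ZMod 2) {v} (hv : v ∈ standardGrading F lam j) := (hb.standardGrading_le j).1 hv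
    have hfC (j : ZMod 2) {v} (hv : v ∈ standardGrading F lam j) := (hb.standardGrading_le j).2.1 hv
    have hhC (j : ZMod 2) {v} (hv : v ∈ standardGrading F lam j) := (hb.standardGrading_le j).2.2 hv
    simp only [Submodule.mem_comap] at heC hfC hhC
    obtain rfl | rfl := i.eq_zero_or_eq_one_of_two
    · have hj : 1 + (1 + j) = j := by
        linear_combination (by decide : (1 + 1 : ZMod 2) = 0)
      have hee := heC _ (heC _ hv)
      have hff := hfC _ (hfC _ hv)
      have hE := hρ 1 1 e ht.e_mem e ht.e_mem
      have hG := hρ 1 1 f ht.f_mem f ht.f_mem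
      rw [hj] at hee hff
      rw [ht.carrier_zero, Submodule.mem_span_triple] at hx
      obtain ⟨a, b, c, rfl⟩ := hx
      simp only [map_add, map_smul, hE, hG, ZMod.val_one, zero_add, mul_one, pow_one, neg_smul,
        one_smul, sub_neg_eq_add, LinearMap.add_apply, LinearMap.smul_apply, Module.End.mul_apply]
      exact Submodule.add_mem _ (Submodule.add_mem _ (Submodule.smul_mem _ _ (hhC _ hv))
        (Submodule.smul_mem _ _ (Submodule.add_mem _ hee hee)))
        (Submodule.smul_mem _ _ (Submodule.add_mem _ hff hff))
    · rw [ht.carrier_one, Submodule.mem_span_pair] at hx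
      obtain ⟨a, b, rfl⟩ := hx
      simp only [map_add, map_smul, LinearMap.add_apply, LinearMap.smul_apply]
      exact add_mem (Submodule.smul_mem _ _ (heC _ hv)) (Submodule.smul_mem _ _ (hfC _ hv))
  · intro i j x hx y hy v
    simpa using LinearMap.congr_fun (hρ i j x hx y hy) v

end StandardModule

/-- (a) nonzero finite-dimensional irreducible `osp(1,2)`-modules have odd
dimension; (b) for each nonnegative even integer `λ` there is an irreducible module of
dimension `λ+1` with the standard basis and action formulas, and every finite-dimensional
irreducible module of dimension `λ+1` is isomorphic to it. -/
theorem osp_irreducible_classification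
    {F : Type} [Field F] [CharZero F] {L : Type} [AddCommGroup L] [Module F L]
    (g : LieSuperAlgebra F L) (e f h : L) (ht : g.IsOspTriple e f h) :
    (∀ (V : Type) [AddCommGroup V] [Module F V], ∀ M : LieSuperModule g V,
        FiniteDimensional F V → M.IsIrreducible → Odd (Module.finrank F V)) ∧
    (∀ lam : ℕ, Even lam →
      ∃ M : LieSuperModule g (Fin (lam + 1) → F),
        (∃ p : ZMod 2,
          M.carrier p = Submodule.span F
            {w : Fin (lam + 1) → F | ∃ i : Fin (lam + 1), Even (i : ℕ) ∧ w = Pi.single i 1} ∧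
          M.carrier (p + 1) = Submodule.span F
            {w : Fin (lam + 1) → F | ∃ i : Fin (lam + 1), ¬ Even (i : ℕ) ∧
              w = Pi.single i 1}) ∧
        (∀ i : Fin (lam + 1),
          (M.act f (Pi.single i (1 : F))
              = if hi : (i : ℕ) + 1 ≤ lam then
                  Pi.single (⟨(i : ℕ) + 1, by omega⟩ : Fin (lam + 1)) 1 else 0) ∧
          (M.act h (Pi.single i (1 : F)) = ((lam : F) - 2 * (i : ℕ)) • (Pi.single i 1 : Fin (lam + 1) → F)) ∧
          (M.act e (Pi.single i (1 : F))
              = if hi : (i : ℕ) = 0 then 0 else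
                  (if Even (i : ℕ) then -((i : ℕ) : F)
                   else (lam : F) - (((i : ℕ) : F) - 1)) •
                    (Pi.single (⟨(i : ℕ) - 1, by omega⟩ : Fin (lam + 1)) 1
                      : Fin (lam + 1) → F))) ∧
        M.IsIrreducible ∧
        (∀ (V : Type) [AddCommGroup V] [Module F V], ∀ N : LieSuperModule g V,
          FiniteDimensional F V → N.IsIrreducible → Module.finrank F V = lam + 1 →
          M.Iso N)) := by

  refine ⟨fun V _ _ M _ hM => ?_, fun lam hlam => ?_⟩
  · obtain ⟨k, p, b, hb, -, hspan⟩ := hM.exists_isWeightString ht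
    rw [hb.finrank_eq hspan]
    exact odd_two_mul_add_one k
  · obtain ⟨M, hMC, hb⟩ := ht.exists_standardModule hlam
    have hspan := span_standardVector (F := F) lam
    refine ⟨M, ⟨0, ?_, ?_⟩, fun i => ⟨?_, ?_, ?_⟩, M.isIrreducible_of_isWeightString hb hspan, ?_⟩
    · simp only [hMC, standardGrading, ZMod.natCast_eq_zero_iff_even, standardVector_coe]
    · simp only [hMC, standardGrading, zero_add, ZMod.natCast_eq_one_iff_odd, standardVector_coe,
        Nat.not_even_iff_odd]
    · rw [← standardVector_coe, hb.f_apply, standardVector]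
      simp only [Nat.lt_succ_iff]
    · rw [← standardVector_coe, hb.h_apply]
    · obtain ⟨i, hi⟩ := i
      rw [← standardVector_coe]
      cases i with
      | zero => simp [hb.e_zero]
      | succ i =>
        rw [hb.e_succ, standardVector, dif_pos (by omega), dif_neg (by simp)]
        rfl
    · intro V _ _ N _ hN hdim
      obtain ⟨k, p, b, hb', hbC, hspan'⟩ := hN.exists_isWeightString ht
      obtain rfl : lam = 2 * k := by
        have := hb'.finrank_eq hspan'
        omega
      exact LieSuperModule.iso_of_isWeightString ht hb hspan (fun j => by rw [hMC]; rfl)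
        hb' hdim hbC
end

section
/- Let (L, h, (·,·)) be an extended affine Lie superalgebra over a field F of characteristic zero with root system R = R₀ ∪ R₁. Suppose i ∈ {0,1} and α ∈ R_i with (α,α) ≠ 0, and set h_α := 2t_α/(α,α). Then there exist y_α ∈ L_i^α and y_{-α} ∈ L_i^{-α} with [y_α, y_{-α}] = h_α, [h_α, y_α] = 2y_α and [h_α, y_{-α}] = -2y_{-α}. In particular, if α ∈ R₁ and (α,α) ≠ 0, then 2α ∈ R₀. -/
/-- A super-toral triple `(L, H, (·,·))`: a nonzero Lie superalgebra with a nontrivial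
abelian subalgebra `H` of the even part, a nondegenerate invariant even supersymmetric
bilinear form whose restriction to `H` is nondegenerate, and a weight space decomposition
of `L` with respect to `H`. -/
structure SuperToral (F : Type) [Field F] (L : Type) [AddCommGroup L] [Module F L]
    extends LieSuperAlgebra F L where
  L_ne : ∃ x : L, x ≠ 0
  H : Submodule F L
  H_le : H ≤ carrier 0
  H_ne_bot : H ≠ ⊥
  H_sub : ∀ x ∈ H, ∀ y ∈ H, bracket x y ∈ H
  form : L →ₗ[F] L →ₗ[F] F
  form_nondeg : ∀ x : L, (∀ y : L, form x y = 0) → x = 0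
  form_inv : ∀ x y z : L, form (bracket x y) z = form x (bracket y z)
  form_even : ∀ x ∈ carrier 0, ∀ y ∈ carrier 1, form x y = 0
  form_super : ∀ i j : ZMod 2, ∀ x ∈ carrier i, ∀ y ∈ carrier j,
    form x y = ((-1 : F) ^ (i.val * j.val)) * form y x
  /-- The weight space attached to a linear functional on `H`. -/
  wt : Module.Dual F ↥H → Submodule F L
  wt_def : ∀ (α : Module.Dual F ↥H) (x : L), x ∈ wt α ↔ ∀ t : ↥H, bracket ↑t x = α t • x
  /-- The weight spaces are independent … -/
  wt_indep : iSupIndep wt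
  /-- … and they span `L`, i.e. `L = ⊕_α L^α`. -/
  wt_sup : (⨆ α : Module.Dual F ↥H, wt α) = ⊤
  form_H_nondeg : ∀ t : ↥H, (∀ s : ↥H, form ↑t ↑s = 0) → t = 0

/-- An extended affine Lie superalgebra: a super-toral triple such that (1) every nonzero
root space pair `(α, -α)` of fixed parity contains elements whose bracket is a nonzero
element of `H`, and (2) for every root `α` with `(α,α) ≠ 0` (expressed via a representative
`t_α ∈ H` of `α` through the form), `ad x` is locally nilpotent for `x ∈ L^α`. -/
structure EALS (F : Type) [Field F] (L : Type) [AddCommGroup L] [Module F L]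
    extends SuperToral F L where
  ax1 : ∀ i : ZMod 2, ∀ α : Module.Dual F ↥H, α ≠ 0 → carrier i ⊓ wt α ≠ ⊥ →
    ∃ x ∈ carrier i ⊓ wt α, ∃ y ∈ carrier i ⊓ wt (-α),
      bracket x y ∈ H ∧ bracket x y ≠ 0
  ax2 : ∀ α : Module.Dual F ↥H, wt α ≠ ⊥ →
    ∀ t : ↥H, (∀ s : ↥H, form ↑t ↑s = α s) → form ↑t ↑t ≠ 0 →
    ∀ x ∈ wt α, ∀ y : L, ∃ n : ℕ, ((bracket x) ^ n) y = 0

namespace SuperToral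

variable {F : Type} [Field F] {L : Type} [AddCommGroup L] [Module F L] (E : SuperToral F L)

/-- Elements of the toral subalgebra are even, so they anticommute with homogeneous elements. -/
theorem bracket_toral_right {i : ZMod 2} {y : L} (hy : y ∈ E.carrier i) (t : ↥E.H) :
    E.bracket y ↑t = -E.bracket ↑t y := by
  simpa using E.skew i 0 y hy ↑t (E.H_le t.2)

/-- If `x` and `y` have opposite weights `α` and `-α` and their bracket is toral, then
`[x, y] = (x, y) t_α`. -/
theorem bracket_eq_form_smul {i : ZMod 2} {α : Module.Dual F ↥E.H} {t : ↥E.H}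
    (ht : ∀ s : ↥E.H, E.form ↑t ↑s = α s) {x y : L} (hy : y ∈ E.carrier i ⊓ E.wt (-α))
    (hxy : E.bracket x y ∈ E.H) :
    E.bracket x y = E.form x y • (t : L) := by
  have key : (⟨E.bracket x y, hxy⟩ : ↥E.H) - E.form x y • t = 0 := by
    refine E.form_H_nondeg _ fun s => ?_
    have hs := (E.wt_def _ _).1 hy.2 s
    simp [E.form_inv, E.bracket_toral_right hy.1 s, hs, ht, mul_comm]
  simpa using congrArg Subtype.val (sub_eq_zero.1 key)

/-- The square of an odd vector of weight `α` is an even vector of weight `2α`. -/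
theorem bracket_self_mem {α : Module.Dual F ↥E.H} {x : L} (hx : x ∈ E.carrier 1 ⊓ E.wt α) :
    E.bracket x x ∈ E.carrier 0 ⊓ E.wt (2 • α) := by
  refine ⟨E.bracket_mem 1 1 x hx.1 x hx.1, (E.wt_def _ _).2 fun t => ?_⟩
  have h := E.super_jacobi 0 1 ↑t (E.H_le t.2) x hx.1 x
  simp only [(E.wt_def _ _).1 hx.2 t, ZMod.val_zero, zero_mul, pow_zero, one_smul, map_smul,
    LinearMap.smul_apply] at h
  rw [← add_eq_of_eq_sub h, LinearMap.smul_apply, two_nsmul, add_smul]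

/-- If odd `x`, `y` satisfy `[x, y] = h` with `h` toral and `[h, x] = 2x`, then
`[y, [x, x]] = 4x`. -/
theorem bracket_bracket_self {x y : L} (hx : x ∈ E.carrier 1) (hy : y ∈ E.carrier 1) (h : ↥E.H)
    (hxy : E.bracket x y = ↑h) (hh : E.bracket ↑h x = (2 : F) • x) :
    E.bracket y (E.bracket x x) = (4 : F) • x := by
  have hyx : E.bracket y x = ↑h := by
    simpa [ZMod.val_one, hxy] using E.skew 1 1 y hy x hx
  have hj := E.super_jacobi 1 1 x hx y hy x
  rw [hxy, hyx, E.bracket_toral_right hx h, hh] at hj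
  simp only [ZMod.val_one, mul_one, pow_one, neg_smul, one_smul, sub_neg_eq_add] at hj
  rw [← sub_eq_iff_eq_add'.2 hj]
  module

end SuperToral

/-- for a nonisotropic root `α ∈ R_i` with `h_α := (2/(α,α))·t_α` there exist
`y_α ∈ L_i^α`, `y_{-α} ∈ L_i^{-α}` with `[y_α, y_{-α}] = h_α`, `[h_α, y_α] = 2 y_α`,
`[h_α, y_{-α}] = -2 y_{-α}`; in particular if `i = 1` then `2α ∈ R₀`. -/
theorem EALS_sl2_super_triple
    {F : Type} [Field F] [CharZero F] {L : Type} [AddCommGroup L] [Module F L]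
    (E : EALS F L) (i : ZMod 2) (α : Module.Dual F ↥E.H)
    (hαR : E.carrier i ⊓ E.wt α ≠ ⊥)
    (tα : ↥E.H) (hrep : ∀ s : ↥E.H, E.form ↑tα ↑s = α s)
    (haa : E.form ↑tα ↑tα ≠ 0) :
    (∃ ya ∈ E.carrier i ⊓ E.wt α, ∃ yb ∈ E.carrier i ⊓ E.wt (-α),
      E.bracket ya yb = (2 / E.form ↑tα ↑tα) • (tα : L) ∧
      E.bracket ((2 / E.form ↑tα ↑tα) • (tα : L)) ya = (2 : F) • ya ∧
      E.bracket ((2 / E.form ↑tα ↑tα) • (tα : L)) yb = -((2 : F) • yb)) ∧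
    (i = 1 → E.carrier 0 ⊓ E.wt (2 • α) ≠ ⊥) := by
  have hα : α ≠ 0 := by
    rintro rfl
    exact haa (by simpa using hrep tα)
  obtain ⟨x, hx, y, hy, hxy, hne⟩ := E.ax1 i α hα hαR
  have hb := E.bracket_eq_form_smul hrep hy hxy
  have hf : E.form x y ≠ 0 := by
    intro h0
    exact hne (by rw [hb, h0, zero_smul])
  set c : F := 2 / E.form ↑tα ↑tα with hc
  have hca : c * α tα = 2 := by rw [← hrep, hc, div_mul_cancel₀ _ haa]
  have hya := (E.carrier i ⊓ E.wt α).smul_mem (c / E.form x y) hx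
  set z := (c / E.form x y) • x with hz
  have hzy : E.bracket z y = c • (tα : L) := by
    rw [hz, map_smul, LinearMap.smul_apply, hb, smul_smul, div_mul_cancel₀ _ hf]
  have hhz : E.bracket (c • (tα : L)) z = (2 : F) • z := by
    rw [LinearMap.map_smul₂, (E.wt_def _ _).1 hya.2 tα, smul_smul, hca]
  have hhy : E.bracket (c • (tα : L)) y = -((2 : F) • y) := by
    rw [LinearMap.map_smul₂, (E.wt_def _ _).1 hy.2 tα, smul_smul,
      LinearMap.neg_apply, mul_neg, hca, neg_smul]
  refine ⟨⟨z, hya, y, hy, hzy, hhz, hhy⟩, ?_⟩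
  rintro rfl hbot
  have hmem := E.bracket_self_mem hya
  rw [hbot, Submodule.mem_bot] at hmem
  have h4 := E.bracket_bracket_self hya.1 hy.1 (c • tα) hzy hhz
  rw [hmem, map_zero, eq_comm, smul_eq_zero_iff_right (by norm_num)] at h4
  have h0 : c • (tα : L) = 0 := by rw [← hzy, h4, map_zero, LinearMap.zero_apply]
  have hc0 : c ≠ 0 := div_ne_zero two_ne_zero haa
  exact haa (by rw [(smul_eq_zero_iff_right hc0).1 h0, map_zero])
end

section
/- Let (L, h, (·,·)) be an extended affine Lie superalgebra over a field F of characteristic zero with root system R = R₀ ∪ R₁. If i, j ∈ {0,1}, α ∈ R_i and β ∈ R_j with (α,β) ≠ 0, then β - α ∈ R or β + α ∈ R. -/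
/-- The bracket of a homogeneous vector of weight `α` with a vector of weight `β` has
weight `α + β`. -/
theorem SuperToral.bracket_mem_wt {F : Type} [Field F] {L : Type} [AddCommGroup L] [Module F L]
    (E : SuperToral F L) {i : ZMod 2} {α β : Module.Dual F ↥E.H} {x z : L}
    (hx : x ∈ E.carrier i) (hxα : x ∈ E.wt α) (hz : z ∈ E.wt β) :
    E.bracket x z ∈ E.wt (α + β) := by
  rw [E.wt_def] at hxα hz ⊢
  intro t
  have h := E.super_jacobi 0 i t (E.H_le t.2) x hx z
  rw [hxα t, hz t] at h
  simp only [ZMod.val_zero, zero_mul, pow_zero, one_smul, map_smul, LinearMap.smul_apply] at h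
  rw [LinearMap.add_apply, add_smul, h, sub_add_cancel]

/-- Pairing `[x, y]` with `s ∈ H`, for `y` homogeneous of weight `-α`. -/
theorem SuperToral.form_bracket_of_mem_wt_neg {F : Type} [Field F] {L : Type} [AddCommGroup L]
    [Module F L] (E : SuperToral F L) {i : ZMod 2} {α : Module.Dual F ↥E.H} {y : L}
    (hy : y ∈ E.carrier i) (hyα : y ∈ E.wt (-α)) (x : L) (s : ↥E.H) :
    E.form (E.bracket x y) s = α s * E.form x y := by
  rw [E.wt_def] at hyα
  rw [E.form_inv, E.skew i 0 y hy s (E.H_le s.2), hyα s]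
  simp

/-- if `α ∈ R_i`, `β ∈ R_j` and `(α,β) ≠ 0`, then `β - α ∈ R` or `β + α ∈ R`. -/
theorem EALS_root_shift
    {F : Type} [Field F] [CharZero F] {L : Type} [AddCommGroup L] [Module F L]
    (E : EALS F L) (i j : ZMod 2) (α β : Module.Dual F ↥E.H)
    (hα : E.carrier i ⊓ E.wt α ≠ ⊥) (hβ : E.carrier j ⊓ E.wt β ≠ ⊥)
    (tα tβ : ↥E.H)
    (hrα : ∀ s : ↥E.H, E.form ↑tα ↑s = α s) (hrβ : ∀ s : ↥E.H, E.form ↑tβ ↑s = β s)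
    (hab : E.form ↑tα ↑tβ ≠ 0) :
    E.wt (β - α) ≠ ⊥ ∨ E.wt (β + α) ≠ ⊥ := by
  by_contra! hbot
  obtain ⟨hsub, hadd⟩ := hbot
  rw [hrα] at hab
  have hα0 : α ≠ 0 := by
    rintro rfl
    exact hab rfl
  obtain ⟨x, ⟨hx, hxα⟩, y, ⟨hy, hyα⟩, hH, hne⟩ := E.ax1 i α hα0 hα
  obtain ⟨z, ⟨-, hz⟩, hz0⟩ := Submodule.exists_mem_ne_zero_of_ne_bot hβ
  have hform := E.form_bracket_of_mem_wt_neg hy hyα x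
  have hxy : E.form x y ≠ 0 := by
    intro h0
    refine hne (congrArg Subtype.val (E.form_H_nondeg ⟨_, hH⟩ fun s => ?_))
    simp [hform s, h0]
  have hxz : E.bracket x z = 0 := by
    have h := E.bracket_mem_wt hx hxα hz
    rwa [add_comm, hadd, Submodule.mem_bot] at h
  have hyz : E.bracket y z = 0 := by
    have h := E.bracket_mem_wt hy hyα hz
    rwa [neg_add_eq_sub, hsub, Submodule.mem_bot] at h
  have hzero : E.bracket (E.bracket x y) z = 0 := by
    rw [E.super_jacobi i i x hx y hy z, hxz, hyz]
    simp
  have hβval : β ⟨_, hH⟩ = α tβ * E.form x y := by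
    rw [← hrβ, ← hform tβ, E.form_super 0 0 _ (E.H_le tβ.2) _ (E.H_le hH)]
    simp
  have hsmul := (E.wt_def β z).1 hz ⟨_, hH⟩
  rw [hβval, hzero] at hsmul
  exact smul_ne_zero (mul_ne_zero hab hxy) hz0 hsmul.symm
end
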